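/- arXiv:1705.09946 — 4 statements merged into one kernel-verified Lean document; each statement's English description precedes it below -/
import Mathlib

section
/- Let N ≥ 2 and let c < N be a real number. Then there exist a positive integer r, an integer m > cr, and a finite set of distinct points p_1,…,p_s ∈ ℙ^N with I = I(Z) the ideal of the reduced scheme Z = p_1+⋯+p_s, such that I^{(m)} ⊄ I^r. -/
open MvPolynomial

noncomputable section

/-- The ideal of polynomials vanishing on the affine cone over the projective point
with homogeneous coordinate vector `p` (i.e. all forms whose homogeneous components
vanish at `p`, for an infinite field). -/
def coneIdeal (K : Type*) [Field K] {n : ℕ} (p : Fin n → K) :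
    Ideal (MvPolynomial (Fin n) K) where
  carrier := {f | ∀ t : K, eval (t • p) f = 0}
  add_mem' := by
    intro a b ha hb t
    simp only [Set.mem_setOf_eq] at ha hb ⊢
    simp [map_add, ha t, hb t]
  zero_mem' := by
    intro t
    simp
  smul_mem' := by
    intro c f hf t
    simp only [Set.mem_setOf_eq] at hf ⊢
    simp [smul_eq_mul, map_mul, hf t]

/-- The degree-`t` homogeneous component of an ideal, as a `K`-vector subspace. -/
def homComp (K : Type*) [Field K] {n : ℕ} (I : Ideal (MvPolynomial (Fin n) K)) (t : ℕ) :
    Submodule K (MvPolynomial (Fin n) K) :=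
  (Submodule.restrictScalars K I) ⊓ homogeneousSubmodule (Fin n) K t

/-- `α(I)` : the least degree `t` such that `[I]_t ≠ 0`. -/
def alphaDeg (K : Type*) [Field K] {n : ℕ} (I : Ideal (MvPolynomial (Fin n) K)) : ℕ :=
  sInf {t : ℕ | homComp K I t ≠ ⊥}

/-- The ideal of the fat point scheme `Z = m_1 p_1 + ⋯ + m_s p_s`. -/
def fatIdeal (K : Type*) [Field K] {n s : ℕ} (p : Fin s → (Fin n → K)) (m : Fin s → ℕ) :
    Ideal (MvPolynomial (Fin n) K) :=
  ⨅ i, (coneIdeal K (p i)) ^ (m i)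

/-- The `k`-th symbolic power `I(kZ)` of the fat point ideal. -/
def symbPow (K : Type*) [Field K] {n s : ℕ} (p : Fin s → (Fin n → K)) (m : Fin s → ℕ)
    (k : ℕ) : Ideal (MvPolynomial (Fin n) K) :=
  fatIdeal K p (fun i => k * m i)

/-- The Waldschmidt constant `α̂(I(Z)) = inf_{k ≥ 1} α(I(kZ))/k`. -/
def waldschmidt (K : Type*) [Field K] {n s : ℕ} (p : Fin s → (Fin n → K)) (m : Fin s → ℕ) :
    ℝ :=
  ⨅ k : ℕ+, (alphaDeg K (symbPow K p m k) : ℝ) / (k : ℝ)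

/-- The vectors `p i` represent distinct points of projective space. -/
def ProjDistinct (K : Type*) [Field K] {n s : ℕ} (p : Fin s → (Fin n → K)) : Prop :=
  (∀ i, p i ≠ 0) ∧ ∀ i j, i ≠ j → ∀ c : K, p i ≠ c • p j


/-- coefficient vector of a polynomial -/
def cvec {K : Type*} [Field K] (N : ℕ) (P : Polynomial K) : Fin (N + 1) → K :=
  fun i => P.coeff i

/-- restriction to the line through `p` -/
def lineHom {K : Type*} [Field K] {n : ℕ} (p : Fin n → K) :
    MvPolynomial (Fin n) K →ₐ[K] Polynomial K :=
  aeval (fun i => Polynomial.C (p i) * Polynomial.X)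

lemma lineHom_homog {K : Type*} [Field K] {n : ℕ} (p : Fin n → K)
    (f : MvPolynomial (Fin n) K) (j : ℕ) (hf : f.IsHomogeneous j) :
    lineHom p f = Polynomial.C (eval p f) * Polynomial.X ^ j := by
  unfold lineHom
  rw [aeval_def, eval₂_eq', eval_eq', map_sum, Finset.sum_mul]
  refine Finset.sum_congr rfl fun d hd => ?_
  have h1 : ∑ i, d i = j := by
    have := hf (mem_support_iff.mp hd)
    rw [← this, ← Finsupp.degree_eq_sum, Finsupp.degree_eq_weight_one]
    rfl
  simp_rw [mul_pow]
  rw [Finset.prod_mul_distrib, Finset.prod_pow_eq_pow_sum, h1, map_mul, map_prod]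
  simp [Polynomial.algebraMap_eq, mul_assoc]

lemma lineHom_coeff {K : Type*} [Field K] {n : ℕ} (p : Fin n → K)
    (f : MvPolynomial (Fin n) K) (j : ℕ) :
    (lineHom p f).coeff j = eval p (homogeneousComponent j f) := by
  conv_lhs => rw [← sum_homogeneousComponent f]
  rw [map_sum, Polynomial.finsetSum_coeff]
  simp_rw [lineHom_homog p _ _ (homogeneousComponent_isHomogeneous _ f),
    Polynomial.coeff_C_mul_X_pow]
  rw [Finset.sum_ite_eq]
  split_ifs with h
  · rfl
  · rw [homogeneousComponent_eq_zero, map_zero]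
    simpa using h

lemma coneIdeal_comp {K : Type*} [Field K] [Infinite K] {n : ℕ} (p : Fin n → K)
    (f : MvPolynomial (Fin n) K) (hf : f ∈ coneIdeal K p) (j : ℕ) :
    eval p (homogeneousComponent j f) = 0 := by
  rw [← lineHom_coeff]
  have : lineHom p f = 0 := by
    apply Polynomial.zero_of_eval_zero
    intro t
    have key : eval (t • p) f = (lineHom p f).eval t := ?_
    · rw [← key]
      exact hf t
    · unfold lineHom
      rw [← Polynomial.coe_evalRingHom, aeval_def, hom_eval₂, ← eval₂_id]
      congr 1
      · ext; simp
      · ext i; simp; exact mul_comm _ _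
  simp [this]

lemma step_lemma {K : Type*} [Field K] (N : ℕ) (F : MvPolynomial (Fin (N + 1)) K) (j : ℕ)
    (hF : F.IsHomogeneous j) (Q : Polynomial K) (A : Finset K) (hA : j < A.card)
    (h : ∀ u ∈ A, eval (cvec N ((Polynomial.X - Polynomial.C u) * Q)) F = 0) (w : K) :
    eval (cvec N ((Polynomial.X - Polynomial.C w) * Q)) F = 0 := by
  set g : Polynomial K := aeval (fun i : Fin (N + 1) =>
    Polynomial.C ((Polynomial.X * Q).coeff i) - Polynomial.X * Polynomial.C (Q.coeff i)) F
    with hg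
  have hev : ∀ u, g.eval u = eval (cvec N ((Polynomial.X - Polynomial.C u) * Q)) F := by
    intro u
    rw [hg, ← Polynomial.coe_evalRingHom, aeval_def, hom_eval₂, ← eval₂_id]
    congr 1
    · ext; simp
    · ext i; simp [cvec, sub_mul]; exact mul_comm _ _
  have hdeg : g.natDegree ≤ j * 1 := by
    apply aeval_natDegree_le _ hF.totalDegree_le
    intro i
    refine (Polynomial.natDegree_sub_le _ _).trans ?_
    refine max_le (by simp) ?_
    refine Polynomial.natDegree_mul_le.trans ?_
    simp
  have h0 : g = 0 := by
    by_contra hne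
    have := Polynomial.card_le_degree_of_subset_roots (p := g) (Z := A) (by
      intro u hu
      rw [Polynomial.mem_roots hne, Polynomial.IsRoot, hev]
      exact h u hu)
    omega
  rw [← hev, h0, Polynomial.eval_zero]

/-- the polynomial with root set `S` -/
def rootPoly {K : Type*} [Field K] (S : Finset K) : Polynomial K :=
  ∏ u ∈ S, (Polynomial.X - Polynomial.C u)

lemma vanish {K : Type*} [Field K] (N k : ℕ) (F : MvPolynomial (Fin (N + 1)) K) (j : ℕ)
    (hj : j ≤ k) (hF : F.IsHomogeneous j) (T : Finset K) (hT : T.card = N + k) (w : K)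
    (h : ∀ S ⊆ T, S.card = N → eval (cvec N (rootPoly S)) F = 0) (e : ℕ) :
    ∀ S ⊆ T, S.card + e = N →
      eval (cvec N ((Polynomial.X - Polynomial.C w) ^ e * rootPoly S)) F = 0 := by
  classical
  induction e with
  | zero => intro S hS hc; simpa using h S hS hc
  | succ e ih =>
    intro S hS hc
    rw [pow_succ', mul_assoc]
    refine step_lemma N F j hF _ (T \ S) ?_ ?_ w
    · rw [Finset.card_sdiff_of_subset hS]; omega
    · intro u hu
      rw [Finset.mem_sdiff] at hu
      have := ih (insert u S) (Finset.insert_subset hu.1 hS)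
        (by rw [Finset.card_insert_of_notMem hu.2]; omega)
      rw [rootPoly, Finset.prod_insert hu.2] at this
      rw [rootPoly, ← this, mul_left_comm]

/-- evaluation at `u` of the polynomial with given coefficients, as a linear form -/
def linForm {K : Type*} [Field K] (N : ℕ) (u : K) : MvPolynomial (Fin (N + 1)) K :=
  ∑ i : Fin (N + 1), C (u ^ (i : ℕ)) * X i

lemma linForm_homog {K : Type*} [Field K] (N : ℕ) (u : K) :
    (linForm N u).IsHomogeneous 1 := by
  refine IsHomogeneous.sum _ _ _ fun i _ => ?_
  simpa using (isHomogeneous_C (Fin (N+1)) (u ^ (i:ℕ))).mul (isHomogeneous_X K i)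

lemma eval_linForm {K : Type*} [Field K] (N : ℕ) (u : K) (P : Polynomial K)
    (hP : P.natDegree ≤ N) : eval (cvec N P) (linForm N u) = P.eval u := by
  rw [Polynomial.eval_eq_sum_range' (n := N + 1) (by omega),
    ← Fin.sum_univ_eq_sum_range (fun i => P.coeff i * u ^ i)]
  simp [linForm, cvec, mul_comm]

lemma rootPoly_natDegree {K : Type*} [Field K] (S : Finset K) :
    (rootPoly S).natDegree = S.card := by
  simp [rootPoly]

lemma rootPoly_monic {K : Type*} [Field K] (S : Finset K) : (rootPoly S).Monic :=
  Polynomial.monic_prod_of_monic _ _ fun u _ => Polynomial.monic_X_sub_C u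

lemma rootPoly_eval {K : Type*} [Field K] (S : Finset K) (u : K) :
    (rootPoly S).eval u = 0 ↔ u ∈ S := by
  simp [rootPoly, Polynomial.eval_prod, Finset.prod_eq_zero_iff, sub_eq_zero]

lemma linForm_mem {K : Type*} [Field K] (N : ℕ) (S : Finset K) (hS : S.card = N) (u : K)
    (hu : u ∈ S) : linForm N u ∈ coneIdeal K (cvec N (rootPoly S)) := by
  intro t
  have h : eval (cvec N (rootPoly S)) (linForm N u) = 0 := by
    rw [eval_linForm _ _ _ (by rw [rootPoly_natDegree, hS]), rootPoly_eval]
    exact hu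
  have : eval (t • cvec N (rootPoly S)) (linForm N u)
      = t * eval (cvec N (rootPoly S)) (linForm N u) := by
    simp only [linForm, map_sum, map_mul, eval_C, eval_X, Pi.smul_apply, smul_eq_mul,
      Finset.mul_sum]
    exact Finset.sum_congr rfl fun i _ => by ring
  rw [this, h, mul_zero]

lemma arith (N : ℕ) (c : ℝ) (hc : c < (N : ℝ)) :
    ∃ k : ℕ, c * ((N + k : ℕ) : ℝ) < ((k * N : ℕ) : ℝ) := by
  obtain ⟨k, hk⟩ := exists_nat_gt (c * N / (N - c))
  refine ⟨k, ?_⟩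
  rw [div_lt_iff₀ (by linarith)] at hk
  push_cast
  linarith


set_option maxHeartbeats 1000000 in
/-- The constant `N` in the containment `I^{(rN)} ⊆ I^r` is optimal: for any real
`c < N` there are a positive integer `r`, an integer `a > cr`, and distinct points
`p_1, …, p_s ∈ ℙ^N` whose reduced-scheme ideal `I` satisfies `I^{(a)} ⊄ I^r`. -/
theorem containment_optimality (K : Type*) [Field K] [IsAlgClosed K]
    (N : ℕ) (hN : 2 ≤ N) (c : ℝ) (hc : c < (N : ℝ)) :
    ∃ (r a s : ℕ) (p : Fin s → (Fin (N + 1) → K)),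
      0 < r ∧ ProjDistinct K p ∧ c * (r : ℝ) < (a : ℝ) ∧
      ¬ symbPow K p (fun _ => 1) a ≤ (fatIdeal K p (fun _ => 1)) ^ r := by
  classical
  have : Infinite K := IsAlgClosed.instInfinite
  obtain ⟨k, hk⟩ := arith N c hc
  obtain ⟨T, hT⟩ := Infinite.exists_subset_card_eq K (N + k)
  obtain ⟨w, hw⟩ := Infinite.exists_notMem_finset T
  set P := T.powersetCard N with hP
  let e := P.equivFin
  have hmem : ∀ i, ((e.symm i : P) : Finset K) ⊆ T ∧ ((e.symm i : P) : Finset K).card = N :=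
    fun i => Finset.mem_powersetCard.mp (e.symm i).2
  have hlead : ∀ i, cvec N (rootPoly ((e.symm i : P) : Finset K)) (Fin.last N) = 1 := by
    intro i
    have h1 := rootPoly_monic ((e.symm i : P) : Finset K)
    have h2 := rootPoly_natDegree ((e.symm i : P) : Finset K)
    rw [(hmem i).2] at h2
    rw [Polynomial.Monic, Polynomial.leadingCoeff, h2] at h1
    simpa [cvec] using h1
  refine ⟨N + k, k * N, P.card, fun i => cvec N (rootPoly ((e.symm i : P) : Finset K)),
    by omega, ⟨?_, ?_⟩, hk, ?_⟩
  · intro i h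
    have := hlead i
    replace h : cvec N (rootPoly ((e.symm i : P) : Finset K)) = 0 := h
    rw [h] at this
    simp at this
  · intro i j hij a h
    replace h : cvec N (rootPoly ((e.symm i : P) : Finset K))
        = a • cvec N (rootPoly ((e.symm j : P) : Finset K)) := h
    have h1 := congrFun h (Fin.last N)
    rw [Pi.smul_apply, hlead, hlead, smul_eq_mul, mul_one] at h1
    rw [← h1, one_smul] at h
    apply hij
    apply e.symm.injective
    apply Subtype.ext
    ext u
    rw [← rootPoly_eval, ← rootPoly_eval,
      ← eval_linForm N u _ (by rw [rootPoly_natDegree, (hmem i).2]),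
      ← eval_linForm N u _ (by rw [rootPoly_natDegree, (hmem j).2]), h]
  · intro hle
    have hG : (∏ u ∈ T, linForm N u) ^ k ∈
        symbPow K (fun i => cvec N (rootPoly ((e.symm i : P) : Finset K)))
          (fun _ => 1) (k * N) := by
      rw [symbPow, fatIdeal, Ideal.mem_iInf]
      intro i
      rw [mul_one, mul_comm, pow_mul]
      apply Ideal.pow_mem_pow
      rw [← Finset.prod_sdiff (hmem i).1]
      apply Ideal.mul_mem_left
      have := Ideal.prod_mem_prod (s := ((e.symm i : P) : Finset K))
        (I := fun _ => coneIdeal K (cvec N (rootPoly ((e.symm i : P) : Finset K))))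
        (x := fun u => linForm N u) (fun u hu => linForm_mem N _ (hmem i).2 u hu)
      rwa [Finset.prod_const, (hmem i).2] at this
    have hmemI := hle hG
    set v := cvec N ((Polynomial.X - Polynomial.C w) ^ N) with hv
    have hI : fatIdeal K (fun i => cvec N (rootPoly ((e.symm i : P) : Finset K)))
        (fun _ => 1) ≤ (Ideal.span {Polynomial.X ^ (k + 1)}).comap (lineHom v) := by
      intro f hf
      rw [fatIdeal, Ideal.mem_iInf] at hf
      rw [Ideal.mem_comap, Ideal.mem_span_singleton, Polynomial.X_pow_dvd_iff]
      intro j hj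
      rw [lineHom_coeff]
      have := vanish N k (homogeneousComponent j f) j (by omega)
        (homogeneousComponent_isHomogeneous _ _) T hT w (by
          intro S hS hc
          have h1 := hf (e ⟨S, Finset.mem_powersetCard.mpr ⟨hS, hc⟩⟩)
          rw [pow_one, Equiv.symm_apply_apply] at h1
          exact coneIdeal_comp _ f h1 j) N ∅ (by simp) (by simp)
      simpa [rootPoly] using this
    have h2 := Ideal.le_comap_pow (lineHom v) (N + k) (Ideal.pow_right_mono hI (N + k) hmemI)
    rw [Ideal.mem_comap, Ideal.span_singleton_pow, Ideal.mem_span_singleton, map_pow, map_prod]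
      at h2
    have h3 : ∀ u ∈ T, lineHom v (linForm N u)
        = Polynomial.C ((u - w) ^ N) * Polynomial.X := by
      intro u _
      rw [lineHom_homog v _ 1 (linForm_homog N u), hv, eval_linForm _ _ _ (by simp)]
      simp
    rw [Finset.prod_congr rfl h3, Finset.prod_mul_distrib, Finset.prod_const, hT,
      ← map_prod, mul_pow, ← map_pow, ← pow_mul, ← pow_mul, Polynomial.X_pow_dvd_iff] at h2
    have h4 := h2 ((N + k) * k) (by nlinarith)
    rw [Polynomial.coeff_C_mul_X_pow, if_pos rfl] at h4
    refine pow_ne_zero _ (Finset.prod_ne_zero_iff.mpr fun u hu => pow_ne_zero _ ?_) h4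
    rw [sub_ne_zero]
    rintro rfl
    exact hw hu

end
end

section
/- Let Z ⊆ ℙ^N be a fat point subscheme and I = I(Z). Define the asymptotic resurgence ρ̂(I) = sup{ m/r : I^{(ms)} ⊄ I^{rs} for all sufficiently large s }, and let ω(I) be the maximal degree among a minimal set of homogeneous generators of I (equivalently, the least d such that I is generated by its homogeneous elements of degree at most d). Then: (a) 1 ≤ ρ̂(I) ≤ ρ(I); and (b) α(I)/α̂(I) ≤ ρ̂(I) ≤ ω(I)/α̂(I). -/
open MvPolynomial

noncomputable section

/-- The resurgence `ρ(I) = sup { a/r : I^{(a)} ⊄ I^r }`. -/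
def resurgence (K : Type*) [Field K] {n s : ℕ} (p : Fin s → (Fin n → K))
    (m : Fin s → ℕ) : ℝ :=
  sSup {x : ℝ | ∃ a r : ℕ, 0 < a ∧ 0 < r ∧
    ¬ symbPow K p m a ≤ (fatIdeal K p m) ^ r ∧ x = (a : ℝ) / (r : ℝ)}

/-- The asymptotic resurgence
`ρ̂(I) = sup { a/r : I^{(at)} ⊄ I^{rt} for all t ≫ 0 }`. -/
def asympResurgence (K : Type*) [Field K] {n s : ℕ} (p : Fin s → (Fin n → K))
    (m : Fin s → ℕ) : ℝ :=
  sSup {x : ℝ | ∃ a r : ℕ, 0 < a ∧ 0 < r ∧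
    (∃ T : ℕ, ∀ t : ℕ, T ≤ t → ¬ symbPow K p m (a * t) ≤ (fatIdeal K p m) ^ (r * t)) ∧
    x = (a : ℝ) / (r : ℝ)}

/-- `ω(I)` : the least `d` such that `I` is generated by its homogeneous elements of
degree at most `d` (the maximal degree in a minimal set of homogeneous generators). -/
def omegaIdeal (K : Type*) [Field K] {n s : ℕ} (p : Fin s → (Fin n → K))
    (m : Fin s → ℕ) : ℕ :=
  sInf {d : ℕ | fatIdeal K p m =
    Ideal.span {f | f ∈ fatIdeal K p m ∧ ∃ t : ℕ, t ≤ d ∧ f.IsHomogeneous t}}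


section helpers

variable {K : Type*} [Field K] {n : ℕ}

def HI (I : Ideal (MvPolynomial (Fin n) K)) : Prop :=
  ∀ f ∈ I, ∀ d, homogeneousComponent d f ∈ I

def Gen (I : Ideal (MvPolynomial (Fin n) K)) (D : ℕ) : Prop :=
  I ≤ Ideal.span {f | f ∈ I ∧ ∃ t : ℕ, t ≤ D ∧ f.IsHomogeneous t}

abbrev mm (K : Type*) [Field K] (n : ℕ) : Ideal (MvPolynomial (Fin n) K) :=
  MvPolynomial.idealOfVars (Fin n) K

lemma HI_iff (I : Ideal (MvPolynomial (Fin n) K)) :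
    HI I ↔ letI := MvPolynomial.gradedAlgebra (σ := Fin n) (R := K)
      I.IsHomogeneous (homogeneousSubmodule (Fin n) K) := by
  let _ := MvPolynomial.gradedAlgebra (σ := Fin n) (R := K)
  constructor
  · intro h i r hr
    have := h r hr i
    rwa [← decomposition.decompose'_apply] at this
  · intro h f hf d
    have := h d hf
    rw [← decomposition.decompose'_apply]
    exact this

lemma HI.mul {I J : Ideal (MvPolynomial (Fin n) K)} (hI : HI I) (hJ : HI J) : HI (I * J) := by
  let _ := MvPolynomial.gradedAlgebra (σ := Fin n) (R := K)
  rw [HI_iff] at *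
  exact Ideal.IsHomogeneous.mul hI hJ

lemma HI.top : HI (⊤ : Ideal (MvPolynomial (Fin n) K)) := fun _ _ _ => trivial

lemma HI.pow {I : Ideal (MvPolynomial (Fin n) K)} (hI : HI I) (k : ℕ) : HI (I ^ k) := by
  induction k with
  | zero => rw [pow_zero, Ideal.one_eq_top]; exact HI.top
  | succ k ih => rw [pow_succ]; exact ih.mul hI

lemma HI.inf {I J : Ideal (MvPolynomial (Fin n) K)} (hI : HI I) (hJ : HI J) : HI (I ⊓ J) :=
  fun f hf d => ⟨hI f hf.1 d, hJ f hf.2 d⟩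

lemma HI.iInf {ι : Type*} {I : ι → Ideal (MvPolynomial (Fin n) K)} (hI : ∀ i, HI (I i)) :
    HI (⨅ i, I i) := by
  intro f hf d
  rw [Ideal.mem_iInf] at *
  exact fun i => hI i f (hf i) d

lemma HI.of_components {I J : Ideal (MvPolynomial (Fin n) K)} (hI : HI I)
    (h : ∀ f ∈ I, ∀ d, f.IsHomogeneous d → f ≠ 0 → f ∈ J) : I ≤ J := by
  intro f hf
  rw [← sum_homogeneousComponent f]
  refine Ideal.sum_mem _ fun i _ => ?_
  by_cases h0 : homogeneousComponent i f = 0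
  · rw [h0]; exact J.zero_mem
  · exact h _ (hI f hf i) i (homogeneousComponent_isHomogeneous i f) h0

lemma HI.exists_gen {I : Ideal (MvPolynomial (Fin n) K)} (hI : HI I) : ∃ D, Gen I D := by
  obtain ⟨S, hS⟩ := (isNoetherianRing_iff_ideal_fg _).1 inferInstance I
  refine ⟨S.sup totalDegree, ?_⟩
  unfold Gen
  have hSI : ∀ f ∈ S, f ∈ I := fun f hf => hS ▸ Ideal.subset_span hf
  conv_lhs => rw [← hS]
  rw [Ideal.span_le]
  intro f hf
  show f ∈ Ideal.span _
  rw [← sum_homogeneousComponent f]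
  refine Ideal.sum_mem _ fun i hi => Ideal.subset_span ⟨hI f (hSI f hf) i, i, ?_, 
    homogeneousComponent_isHomogeneous i f⟩
  have := Finset.le_sup (f := totalDegree) hf
  simp at hi
  omega

lemma Gen.mono {I : Ideal (MvPolynomial (Fin n) K)} {D E : ℕ} (h : Gen I D) (hDE : D ≤ E) :
    Gen I E :=
  h.trans (Ideal.span_mono fun _ ⟨hf, t, ht, hh⟩ => ⟨hf, t, ht.trans hDE, hh⟩)

lemma Gen.mul {I J : Ideal (MvPolynomial (Fin n) K)} {D E : ℕ} (hI : Gen I D) (hJ : Gen J E) :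
    Gen (I * J) (D + E) := by
  unfold Gen
  refine (Ideal.mul_mono hI hJ).trans ?_
  rw [Ideal.span_mul_span', Ideal.span_le]
  rintro _ ⟨f, ⟨hf, t, ht, hft⟩, g, ⟨hg, u, hu, hgu⟩, rfl⟩
  exact Ideal.subset_span ⟨Ideal.mul_mem_mul hf hg, t + u, by omega, hft.mul hgu⟩

lemma hom_mem_mm_pow {f : MvPolynomial (Fin n) K} {t l : ℕ} (hf : f.IsHomogeneous t)
    (h : l ≤ t) : f ∈ mm K n ^ l := by
  rw [mem_pow_idealOfVars_iff]
  intro x hx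
  have := hf (mem_support_iff.1 hx)
  have h3 : Finsupp.degree x = t := by rw [← this, Finsupp.degree_eq_weight_one]; rfl
  omega

lemma le_of_hom_mem {f : MvPolynomial (Fin n) K} {t l : ℕ} (hf : f.IsHomogeneous t)
    (h0 : f ≠ 0) (h : f ∈ mm K n ^ l) : l ≤ t := by
  obtain ⟨x, hx⟩ := exists_coeff_ne_zero h0
  rw [mem_pow_idealOfVars_iff] at h
  have h1 := h x (mem_support_iff.2 hx)
  have h2 := hf hx
  have h3 : Finsupp.degree x = t := by rw [← h2, Finsupp.degree_eq_weight_one]; rfl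
  omega

lemma comp_mul {a g : MvPolynomial (Fin n) K} {e t : ℕ} (hg : g.IsHomogeneous e) (h : e ≤ t) :
    homogeneousComponent t (a * g) = homogeneousComponent (t - e) a * g := by
  conv_lhs => rw [← sum_homogeneousComponent a, Finset.sum_mul, map_sum]
  have : ∀ i, homogeneousComponent t (homogeneousComponent i a * g) =
      if i = t - e then homogeneousComponent i a * g else 0 := by
    intro i
    rw [homogeneousComponent_of_mem ((homogeneousComponent_isHomogeneous i a).mul hg)]
    have : t = i + e ↔ i = t - e := by omega
    simp only [this]
  simp only [this, Finset.sum_ite_eq']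
  split_ifs with hi
  · rfl
  · simp at hi
    rw [homogeneousComponent_eq_zero _ _ (by omega), zero_mul]

lemma Gen.mem {I : Ideal (MvPolynomial (Fin n) K)} {D l t : ℕ} (hI : Gen I D)
    {f : MvPolynomial (Fin n) K} (hf : f ∈ I) (hft : f.IsHomogeneous t) (h : D + l ≤ t) :
    f ∈ mm K n ^ l * I := by
  have key : ∀ f ∈ Ideal.span {f | f ∈ I ∧ ∃ t : ℕ, t ≤ D ∧ f.IsHomogeneous t},
      ∀ a, homogeneousComponent t (a * f) ∈ mm K n ^ l * I := by
    intro f hf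
    induction hf using Submodule.span_induction with
    | mem g hg =>
      obtain ⟨hg, e, he, hge⟩ := hg
      intro a
      rw [comp_mul hge (by omega)]
      exact Ideal.mul_mem_mul
        (hom_mem_mm_pow (homogeneousComponent_isHomogeneous _ _) (by omega)) hg
    | zero => intro a; simp
    | add x y _ _ hx hy =>
      intro a
      rw [mul_add, map_add]
      exact Ideal.add_mem _ (hx a) (hy a)
    | smul b x _ hx =>
      intro a
      rw [smul_eq_mul, ← mul_assoc]
      exact hx _
  have := key f (hI hf) 1
  rwa [one_mul, homogeneousComponent_eq_self hft] at this

/-- abstract regularity bound -/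
lemma reg_bound (I : Ideal (MvPolynomial (Fin n) K)) (S : ℕ → Ideal (MvPolynomial (Fin n) K))
    (hI : HI I) (hS : ∀ k, HI (S k)) (hanti : ∀ k, S (k + 1) ≤ S k)
    (hmul : ∀ k, I * S k ≤ S (k + 1))
    (hsat : ∀ k, ∃ l, mm K n ^ l * S k ≤ I ^ k) (w : ℕ) (hw : Gen I w) :
    ∃ c, ∀ r t f, f ∈ S r → f.IsHomogeneous t → r * w + c ≤ t → f ∈ I ^ r := by
  let F : I.Filtration (MvPolynomial (Fin n) K) :=
    { N := fun j => I ^ j ⊓ S (j + 1)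
      mono := fun j => inf_le_inf (Ideal.pow_le_pow_right (by omega)) (hanti _)
      smul_le := fun j => by
        rw [smul_eq_mul]
        refine le_inf ?_ ((Ideal.mul_mono_right inf_le_right).trans (hmul _))
        rw [pow_succ']
        exact Ideal.mul_mono_right inf_le_left }
  have hF : F.Stable := by
    refine Ideal.Filtration.Stable.of_le (I.stableFiltration_stable ⊤) ?_
    intro j
    show I ^ j ⊓ S (j + 1) ≤ I ^ j • ⊤
    simp
  obtain ⟨j0, hj0⟩ := hF
  have hj0 : ∀ j ≥ j0, I * (I ^ j ⊓ S (j + 1)) = I ^ (j + 1) ⊓ S (j + 1 + 1) := hj0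
  choose l hl using hsat
  choose D hD using fun j => ((hI.pow j).inf (hS (j + 1))).exists_gen
  let L := (Finset.range (j0 + 1)).sup fun j => l (j + 1)
  let DD := (Finset.range (j0 + 1)).sup D
  have main : ∀ j, Gen (I ^ j ⊓ S (j + 1)) (j * w + DD) ∧
      mm K n ^ L * (I ^ j ⊓ S (j + 1)) ≤ I ^ (j + 1) := by
    intro j
    have small : ∀ j ≤ j0, Gen (I ^ j ⊓ S (j + 1)) (j * w + DD) ∧
      mm K n ^ L * (I ^ j ⊓ S (j + 1)) ≤ I ^ (j + 1) := by
      intro j hj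
      have hj' : j ∈ Finset.range (j0 + 1) := by simp; omega
      refine ⟨(hD j).mono ?_, ?_⟩
      · have : D j ≤ DD := Finset.le_sup (f := D) hj'
        omega
      · have : l (j + 1) ≤ L := Finset.le_sup (f := fun j => l (j + 1)) hj'
        exact (Ideal.mul_mono (Ideal.pow_le_pow_right this) inf_le_right).trans (hl (j + 1))
    induction j with
    | zero => exact small 0 (by omega)
    | succ j ih =>
      by_cases hj : j + 1 ≤ j0
      · exact small _ hj
      · rw [← hj0 j (by omega)]
        refine ⟨(hw.mul ih.1).mono (by rw [add_mul]; omega), ?_⟩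
        rw [mul_left_comm, pow_succ']
        exact Ideal.mul_mono_right ih.2
  refine ⟨DD + L, fun r t f hf hft ht => ?_⟩
  have hSa : Antitone S := antitone_nat_of_succ_le hanti
  have : ∀ j ≤ r, f ∈ I ^ j := by
    intro j
    induction j with
    | zero => simp
    | succ j ih =>
      intro hj
      have h1 : f ∈ I ^ j ⊓ S (j + 1) := ⟨ih (by omega), hSa hj hf⟩
      refine (main j).2 ((main j).1.mem h1 hft ?_)
      have : j * w ≤ r * w := Nat.mul_le_mul_right _ (by omega)
      omega
  exact this r le_rfl


lemma hom_eval_smul {f : MvPolynomial (Fin n) K} {d : ℕ} (hf : f.IsHomogeneous d) (t : K)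
    (p : Fin n → K) : eval (t • p) f = t ^ d * eval p f := by
  rw [eval_eq, eval_eq, Finset.mul_sum]
  refine Finset.sum_congr rfl fun x hx => ?_
  have h2 := hf (mem_support_iff.1 hx)
  have h3 : Finsupp.degree x = d := by rw [← h2, Finsupp.degree_eq_weight_one]; rfl
  have h4 : ∏ i ∈ x.support, t ^ x i = t ^ d := by
    rw [Finset.prod_pow_eq_pow_sum, ← h3]; rfl
  simp only [Pi.smul_apply, smul_eq_mul, mul_pow, Finset.prod_mul_distrib]
  rw [h4]; ring

lemma coneIdeal_le_mm (p : Fin n → K) : coneIdeal K p ≤ mm K n := by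
  intro f hf
  have h0 : eval ((0 : K) • p) f = 0 := hf 0
  rw [← pow_one (mm K n), mem_pow_idealOfVars_iff']
  intro x hx
  have : x = 0 := by
    rw [← Finsupp.degree_eq_zero_iff]; omega
  subst this
  rw [zero_smul, MvPolynomial.eval_zero] at h0
  exact h0

lemma linear_mem_cone {p : Fin n → K} {f : MvPolynomial (Fin n) K}
    (hf : f.IsHomogeneous 1) (h : eval p f = 0) : f ∈ coneIdeal K p := by
  intro t
  rw [hom_eval_smul hf, h]
  simp

lemma HI_cone [Infinite K] (p : Fin n → K) : HI (coneIdeal K p) := by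
  intro f hf d t
  have hf : ∀ t : K, eval (t • p) f = 0 := hf
  have hs : ∀ (t : K) d, eval (t • p) (homogeneousComponent d f) =
      t ^ d * eval p (homogeneousComponent d f) := fun t d => by
    rw [hom_eval_smul (homogeneousComponent_isHomogeneous d f)]
  let P : Polynomial K := ∑ i ∈ Finset.range (f.totalDegree + 1),
    Polynomial.C (eval p (homogeneousComponent i f)) * Polynomial.X ^ i
  have hP : P = 0 := by
    apply Polynomial.funext
    intro t
    have := hf t
    rw [← sum_homogeneousComponent f, map_sum] at this
    simp only [hs] at this
    simp only [P, Polynomial.eval_finsetSum, Polynomial.eval_mul, Polynomial.eval_C,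
      Polynomial.eval_pow, Polynomial.eval_X, Polynomial.eval_zero]
    rw [← this]
    exact Finset.sum_congr rfl fun i _ => mul_comm _ _
  rw [hs]
  by_cases hd : d < f.totalDegree + 1
  · have : P.coeff d = 0 := by rw [hP]; simp
    simp only [P, Polynomial.finsetSum_coeff, Polynomial.coeff_C_mul_X_pow] at this
    rw [Finset.sum_ite_eq] at this
    simp only [Finset.mem_range, hd, if_true] at this
    rw [this, mul_zero]
  · rw [homogeneousComponent_eq_zero _ _ (by omega)]; simp

lemma mm_le_sup {p q : Fin n → K} (hp : p ≠ 0) (hpq : ∀ c : K, q ≠ c • p) :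
    mm K n ≤ coneIdeal K p ⊔ coneIdeal K q := by
  obtain ⟨k, hk⟩ := Function.ne_iff.1 hp
  have hk : p k ≠ 0 := hk
  obtain ⟨l, hl⟩ := Function.ne_iff.1 (hpq (q k / p k))
  have hd : q l * p k - q k * p l ≠ 0 := by
    intro h
    apply hl
    simp only [Pi.smul_apply, smul_eq_mul]
    field_simp
    linear_combination h
  set d := q l * p k - q k * p l with hdd
  unfold mm idealOfVars
  rw [Ideal.span_le]
  rintro _ ⟨i, rfl⟩
  show X i ∈ coneIdeal K p ⊔ coneIdeal K q
  have hC : ∀ (c : K) j, (C c * X j : MvPolynomial (Fin n) K).IsHomogeneous 1 := fun c j => by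
    simpa using (isHomogeneous_C (Fin n) c).mul (isHomogeneous_X K j)
  have hL : (C (p k) * X l - C (p l) * X k : MvPolynomial (Fin n) K) ∈ coneIdeal K p :=
    linear_mem_cone ((hC _ _).sub (hC _ _)) (by simp; ring)
  have hL' : (C (q l) * X k - C (q k) * X l : MvPolynomial (Fin n) K) ∈ coneIdeal K q :=
    linear_mem_cone ((hC _ _).sub (hC _ _)) (by simp; ring)
  have hM : (C d * X i - C (p i) * (C (q l) * X k - C (q k) * X l)
      - C (q i) * (C (p k) * X l - C (p l) * X k) : MvPolynomial (Fin n) K) ∈ coneIdeal K p := by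
    refine linear_mem_cone (((hC _ _).sub ?_).sub ?_) (by simp [hdd]; ring)
    · simpa using (isHomogeneous_C (Fin n) (p i)).mul ((hC (q l) k).sub (hC (q k) l))
    · simpa using (isHomogeneous_C (Fin n) (q i)).mul ((hC (p k) l).sub (hC (p l) k))
  have h1 : (C d * X i : MvPolynomial (Fin n) K) ∈ coneIdeal K p ⊔ coneIdeal K q := by
    have a1 := Ideal.mem_sup_left (T := coneIdeal K q) hM
    have a2 := Ideal.mem_sup_left (T := coneIdeal K q) (Ideal.mul_mem_left _ (C (q i)) hL)
    have a3 := Ideal.mem_sup_right (S := coneIdeal K p) (Ideal.mul_mem_left _ (C (p i)) hL')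
    have := Ideal.add_mem _ (Ideal.add_mem _ a1 a2) a3
    convert this using 1
    ring
  have := Ideal.mul_mem_left _ (C d⁻¹) h1
  rwa [← mul_assoc, ← C_mul, inv_mul_cancel₀ hd, C_1, one_mul] at this

/-- comaximal up to `M`-power -/
def Com {R : Type*} [CommRing R] (M A B : Ideal R) : Prop := ∃ k, M ^ k ≤ A ⊔ B

lemma Com.symm {R : Type*} [CommRing R] {M A B : Ideal R} (h : Com M A B) : Com M B A := by
  unfold Com at *; rwa [sup_comm]

lemma Com.top {R : Type*} [CommRing R] {M A : Ideal R} : Com M A 1 := ⟨0, by simp⟩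

lemma Com.mul {R : Type*} [CommRing R] {M A B B' : Ideal R} (h : Com M A B) (h' : Com M A B') :
    Com M A (B * B') := by
  obtain ⟨k, hk⟩ := h
  obtain ⟨k', hk'⟩ := h'
  refine ⟨k + k', ?_⟩
  rw [pow_add]
  refine (Ideal.mul_mono hk hk').trans ?_
  rw [Ideal.sup_mul, Ideal.mul_sup B]
  exact sup_le (Ideal.mul_le_left.trans le_sup_left)
    (sup_le (Ideal.mul_le_right.trans le_sup_left) le_sup_right)

lemma Com.pow {R : Type*} [CommRing R] {M A B : Ideal R} (h : Com M A B) (j : ℕ) :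
    Com M A (B ^ j) := by
  induction j with
  | zero => rw [pow_zero]; exact Com.top
  | succ j ih => rw [pow_succ]; exact ih.mul h

lemma Com.prod {R ι : Type*} [CommRing R] {M A : Ideal R} {B : ι → Ideal R} (S : Finset ι)
    (h : ∀ i ∈ S, Com M A (B i)) : Com M A (∏ i ∈ S, B i) := by
  classical
  induction S using Finset.induction_on with
  | empty => exact Com.top
  | insert a S ha ih =>
    rw [Finset.prod_insert ha]
    exact (h a (by simp)).mul (ih fun i hi => h i (by simp [hi]))

lemma Com.inf_le_prod {R ι : Type*} [CommRing R] {M : Ideal R} {B : ι → Ideal R} (S : Finset ι)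
    (h : ∀ i ∈ S, ∀ j ∈ S, i ≠ j → Com M (B i) (B j)) :
    ∃ l, M ^ l * (S.inf B) ≤ ∏ i ∈ S, B i := by
  classical
  induction S using Finset.induction_on with
  | empty => exact ⟨0, by simp⟩
  | insert a S ha ih =>
    obtain ⟨l, hl⟩ := ih fun i hi j hj => h i (by simp [hi]) j (by simp [hj])
    obtain ⟨k, hk⟩ : Com M (B a) (∏ i ∈ S, B i) := Com.prod S fun i hi =>
      h a (by simp) i (by simp [hi]) (by rintro rfl; exact ha hi)
    refine ⟨k + l, ?_⟩
    rw [Finset.prod_insert ha, Finset.inf_insert, pow_add, mul_assoc]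
    have h1 : M ^ l * (B a ⊓ S.inf B) ≤ ∏ i ∈ S, B i :=
      (Ideal.mul_mono_right inf_le_right).trans hl
    have h2 : M ^ l * (B a ⊓ S.inf B) ≤ B a := Ideal.mul_le_right.trans inf_le_left
    refine (Ideal.mul_mono_left hk).trans ?_
    rw [Ideal.sup_mul]
    refine sup_le (Ideal.mul_mono_right h1) ?_
    rw [mul_comm (B a)]
    exact Ideal.mul_mono_right h2

lemma symb_sat {s : ℕ} (p : Fin s → (Fin n → K)) (hp : ProjDistinct K p) (m : Fin s → ℕ) (k : ℕ) :
    ∃ l, mm K n ^ l * symbPow K p m k ≤ fatIdeal K p m ^ k := by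
  obtain ⟨l, hl⟩ := Com.inf_le_prod (M := mm K n)
    (B := fun i => coneIdeal K (p i) ^ (k * m i)) Finset.univ (by
      intro i _ j _ hij
      have : Com (mm K n) (coneIdeal K (p i)) (coneIdeal K (p j)) :=
        ⟨1, by rw [pow_one]; exact mm_le_sup (hp.1 i) (hp.2 j i hij.symm)⟩
      exact ((this.pow _).symm.pow _).symm)
  refine ⟨l, ?_⟩
  rw [Finset.inf_univ_eq_iInf] at hl
  refine hl.trans ?_
  have : ∏ i, coneIdeal K (p i) ^ (k * m i) = (∏ i, coneIdeal K (p i) ^ m i) ^ k := by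
    rw [← Finset.prod_pow]
    exact Finset.prod_congr rfl fun i _ => by rw [mul_comm, pow_mul]
  rw [this]
  refine Ideal.pow_right_mono ?_ k
  refine Ideal.prod_le_inf.trans ?_
  rw [Finset.inf_univ_eq_iInf]
  rfl

lemma symb_anti {s : ℕ} (p : Fin s → (Fin n → K)) (m : Fin s → ℕ) : Antitone (symbPow K p m) :=
  fun _ _ h => iInf_mono fun _ => Ideal.pow_le_pow_right (Nat.mul_le_mul_right _ h)

lemma symb_mul {s : ℕ} (p : Fin s → (Fin n → K)) (m : Fin s → ℕ) (j k : ℕ) :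
    symbPow K p m j * symbPow K p m k ≤ symbPow K p m (j + k) := by
  refine le_iInf fun i => ?_
  simp only [add_mul, pow_add]
  exact Ideal.mul_mono (iInf_le _ i) (iInf_le _ i)

lemma symb_one {s : ℕ} (p : Fin s → (Fin n → K)) (m : Fin s → ℕ) :
    symbPow K p m 1 = fatIdeal K p m := by
  simp [symbPow]

lemma symb_HI [Infinite K] {s : ℕ} (p : Fin s → (Fin n → K)) (m : Fin s → ℕ) (k : ℕ) :
    HI (symbPow K p m k) := HI.iInf fun i => (HI_cone (p i)).pow _

lemma symb_le_mm {s : ℕ} (p : Fin s → (Fin n → K)) (m : Fin s → ℕ) (hm : ∃ i, 0 < m i) (k : ℕ) :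
    symbPow K p m k ≤ mm K n ^ k := by
  obtain ⟨i, hi⟩ := hm
  refine (iInf_le _ i).trans ((Ideal.pow_right_mono (coneIdeal_le_mm (p i)) _).trans
    (Ideal.pow_le_pow_right ?_))
  exact Nat.le_mul_of_pos_right k hi

lemma cone_ne_bot {N : ℕ} (hN : 1 ≤ N) (p : Fin (N + 1) → K) (hp : p ≠ 0) :
    coneIdeal K p ≠ ⊥ := by
  obtain ⟨k, hk⟩ := Function.ne_iff.1 hp
  have hk : p k ≠ 0 := hk
  have : Nontrivial (Fin (N + 1)) := Fin.nontrivial_iff_two_le.2 (by omega)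
  obtain ⟨l, hl⟩ := exists_ne k
  have hC : ∀ (c : K) j, (C c * X j : MvPolynomial (Fin (N + 1)) K).IsHomogeneous 1 := fun c j => by
    simpa using (isHomogeneous_C (Fin (N + 1)) c).mul (isHomogeneous_X K j)
  have hL : (C (p k) * X l - C (p l) * X k : MvPolynomial (Fin (N + 1)) K) ∈ coneIdeal K p :=
    linear_mem_cone ((hC _ _).sub (hC _ _)) (by simp; ring)
  intro h
  rw [h, Ideal.mem_bot] at hL
  have := congrArg (eval (Pi.single l 1)) hL
  simp [hl.symm] at this
  exact hk this

lemma symb_ne_bot {N s : ℕ} (hN : 1 ≤ N) (p : Fin s → (Fin (N + 1) → K)) (hp : ∀ i, p i ≠ 0)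
    (m : Fin s → ℕ) (k : ℕ) : symbPow K p m k ≠ ⊥ := by
  have h1 : ∏ i, coneIdeal K (p i) ^ (k * m i) ≤ symbPow K p m k := by
    refine Ideal.prod_le_inf.trans ?_
    rw [Finset.inf_univ_eq_iInf]
    rfl
  have h2 : ∏ i, coneIdeal K (p i) ^ (k * m i) ≠ ⊥ := by
    rw [← Ideal.zero_eq_bot]
    exact Finset.prod_ne_zero_iff.2 fun i _ => pow_ne_zero _ (cone_ne_bot hN _ (hp i))
  intro h
  rw [h, le_bot_iff] at h1
  exact h2 h1

lemma alpha_le {I : Ideal (MvPolynomial (Fin n) K)} {f : MvPolynomial (Fin n) K} {t : ℕ}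
    (hf : f ∈ I) (h0 : f ≠ 0) (ht : f.IsHomogeneous t) : alphaDeg K I ≤ t := by
  refine Nat.sInf_le ?_
  show homComp K I t ≠ ⊥
  rw [Submodule.ne_bot_iff]
  exact ⟨f, ⟨hf, ht⟩, h0⟩

lemma alpha_exists {I : Ideal (MvPolynomial (Fin n) K)} (hI : HI I) (hb : I ≠ ⊥) :
    ∃ f ∈ I, f ≠ 0 ∧ f.IsHomogeneous (alphaDeg K I) := by
  have : alphaDeg K I ∈ {t : ℕ | homComp K I t ≠ ⊥} := by
    refine Nat.sInf_mem ?_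
    by_contra hne
    apply hb
    rw [← le_bot_iff]
    refine hI.of_components fun f hf d hd h0 => ?_
    exfalso
    apply hne
    refine ⟨d, ?_⟩
    show homComp K I d ≠ ⊥
    rw [Submodule.ne_bot_iff]
    exact ⟨f, ⟨hf, hd⟩, h0⟩
  have : homComp K I (alphaDeg K I) ≠ ⊥ := this
  rw [Submodule.ne_bot_iff] at this
  obtain ⟨f, ⟨h1, h2⟩, h3⟩ := this
  exact ⟨f, h1, h3, h2⟩

lemma le_mm_alpha {I : Ideal (MvPolynomial (Fin n) K)} (hI : HI I) :
    I ≤ mm K n ^ alphaDeg K I :=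
  hI.of_components fun _ hf _ hd h0 => hom_mem_mm_pow hd (alpha_le hf h0 hd)


lemma wald_le {s : ℕ} (p : Fin s → (Fin n → K)) (m : Fin s → ℕ) (k : ℕ) (hk : 0 < k) :
    waldschmidt K p m ≤ (alphaDeg K (symbPow K p m k) : ℝ) / k := by
  refine ciInf_le (f := fun k : ℕ+ => (alphaDeg K (symbPow K p m k) : ℝ) / (k : ℝ)) ?_ ⟨k, hk⟩
  exact ⟨0, by rintro _ ⟨k, rfl⟩; positivity⟩

lemma le_wald {N s : ℕ} (hN : 1 ≤ N) (p : Fin s → (Fin (N + 1) → K)) [Infinite K]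
    (hp : ∀ i, p i ≠ 0) (m : Fin s → ℕ) (hm : ∃ i, 0 < m i) : 1 ≤ waldschmidt K p m := by
  refine le_ciInf fun k => ?_
  have hk : (0 : ℝ) < (k : ℕ) := by exact_mod_cast k.pos
  rw [le_div_iff₀ hk, one_mul]
  obtain ⟨f, hf, h0, hd⟩ := alpha_exists (symb_HI p m k) (symb_ne_bot hN p hp m k)
  exact_mod_cast le_of_hom_mem hd h0 (symb_le_mm p m hm k hf)

lemma omega_gen [Infinite K] {s : ℕ} (p : Fin s → (Fin n → K)) (m : Fin s → ℕ) :
    Gen (fatIdeal K p m) (omegaIdeal K p m) := by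
  have h : omegaIdeal K p m ∈ {d : ℕ | fatIdeal K p m =
      Ideal.span {f | f ∈ fatIdeal K p m ∧ ∃ t : ℕ, t ≤ d ∧ f.IsHomogeneous t}} := by
    refine Nat.sInf_mem ?_
    have hI : HI (fatIdeal K p m) := by rw [← symb_one]; exact symb_HI p m 1
    obtain ⟨D, hD⟩ := hI.exists_gen
    exact ⟨D, le_antisymm hD (Ideal.span_le.2 fun f hf => hf.1)⟩
  exact le_of_eq h

lemma alpha_le_of_gen {I : Ideal (MvPolynomial (Fin n) K)} {D : ℕ} (h : Gen I D) (hb : I ≠ ⊥) :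
    alphaDeg K I ≤ D := by
  by_contra hlt
  apply hb
  rw [← le_bot_iff]
  refine h.trans (Ideal.span_le.2 ?_)
  rintro f ⟨hf, t, ht, hft⟩
  by_contra h0
  have := alpha_le hf h0 hft
  omega

lemma contain {N s : ℕ} (hN : 1 ≤ N) (p : Fin s → (Fin (N + 1) → K)) [Infinite K]
    (hp : ProjDistinct K p) (m : Fin s → ℕ) (hm : ∃ i, 0 < m i) (w : ℕ)
    (hw : Gen (fatIdeal K p m) w) :
    ∃ c : ℕ, ∀ a r : ℕ, 0 < a → r ≤ a → (r * w + c : ℝ) ≤ a * waldschmidt K p m →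
      symbPow K p m a ≤ fatIdeal K p m ^ r := by
  obtain ⟨c, hc⟩ := reg_bound (fatIdeal K p m) (symbPow K p m)
    (by rw [← symb_one]; exact symb_HI p m 1) (symb_HI p m)
    (fun k => symb_anti p m (by omega))
    (fun k => by
      have := symb_mul p m 1 k
      rwa [symb_one, add_comm 1 k] at this)
    (symb_sat p hp m) w hw
  refine ⟨c, fun a r ha hra h => (symb_HI p m a).of_components fun f hf d hd h0 => ?_⟩
  refine hc r d f (symb_anti p m hra hf) hd ?_
  have h1 := wald_le p m a ha
  have h2 : (alphaDeg K (symbPow K p m a) : ℝ) ≤ d := by exact_mod_cast alpha_le hf h0 hd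
  rw [le_div_iff₀ (by exact_mod_cast ha)] at h1
  have : (r * w + c : ℝ) ≤ d := by linarith
  exact_mod_cast this

lemma symb_pow_le {s : ℕ} (p : Fin s → (Fin n → K)) (m : Fin s → ℕ) (k q : ℕ) :
    symbPow K p m k ^ q ≤ symbPow K p m (k * q) := by
  induction q with
  | zero => simp [symbPow, fatIdeal]
  | succ q ih =>
    rw [pow_succ, mul_add, mul_one]
    exact (Ideal.mul_mono_left ih).trans (symb_mul p m _ _)

lemma lower {N s : ℕ} (hN : 1 ≤ N) (p : Fin s → (Fin (N + 1) → K)) [Infinite K]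
    (hp : ∀ i, p i ≠ 0) (m : Fin s → ℕ) (a r : ℕ) (ha : 0 < a) (hr : 0 < r)
    (h : a * waldschmidt K p m < r * alphaDeg K (fatIdeal K p m)) :
    ∃ T : ℕ, ∀ t : ℕ, T ≤ t → ¬ symbPow K p m (a * t) ≤ (fatIdeal K p m) ^ (r * t) := by
  have ha' : (0 : ℝ) < a := by exact_mod_cast ha
  set A := alphaDeg K (fatIdeal K p m)
  have h1 : waldschmidt K p m < r * A / a := by rw [lt_div_iff₀ ha']; linarith
  obtain ⟨k, hk⟩ := exists_lt_of_ciInf_lt h1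
  have hk0 : (0 : ℝ) < (k : ℕ) := by exact_mod_cast k.pos
  have hkn : 0 < (k : ℕ) := k.pos
  generalize (k : ℕ) = k at *
  set B := alphaDeg K (symbPow K p m k)
  rw [div_lt_div_iff₀ hk0 ha'] at hk
  have hk' : B * a + 1 ≤ r * A * k := by exact_mod_cast hk
  refine ⟨B * k + 1, fun t ht hle => ?_⟩
  obtain ⟨f, hf, h0, hd⟩ := alpha_exists (symb_HI p m k) (symb_ne_bot hN p hp m k)
  set q := a * t / k + 1 with hq
  have hq1 : a * t ≤ k * q := by
    have := Nat.lt_div_mul_add (a := a * t) hkn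
    rw [hq, mul_add, mul_comm k]; omega
  have hq2 : k * q ≤ a * t + k := by
    have := Nat.mul_div_le (a * t) k
    rw [hq, mul_add]; omega
  have hfq : f ^ q ∈ symbPow K p m (a * t) :=
    symb_anti p m hq1 (symb_pow_le p m k q (Ideal.pow_mem_pow hf q))
  have hI : HI (fatIdeal K p m) := by rw [← symb_one]; exact symb_HI p m 1
  have h2 := Ideal.pow_right_mono (le_mm_alpha hI) (r * t) (hle hfq)
  rw [← pow_mul] at h2
  have h3 := le_of_hom_mem (hd.pow q) (pow_ne_zero q h0) h2
  -- A * (r t) ≤ B q ; times k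
  change A * (r * t) ≤ B * q at h3
  have h4 : A * (r * t) * k ≤ B * (a * t + k) := by
    calc A * (r * t) * k ≤ B * q * k := Nat.mul_le_mul_right _ h3
      _ = B * (k * q) := by ring
      _ ≤ _ := Nat.mul_le_mul_left _ hq2
  have h5 : (B * a + 1) * t ≤ r * A * k * t := Nat.mul_le_mul_right _ hk'
  nlinarith

end helpers

set_option maxHeartbeats 1000000 in
/-- Bounds for the asymptotic resurgence of a fat point ideal `I = I(Z)`:
(a) `1 ≤ ρ̂(I) ≤ ρ(I)`; (b) `α(I)/α̂(I) ≤ ρ̂(I) ≤ ω(I)/α̂(I)`. -/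
theorem asymptotic_resurgence_bounds (K : Type*) [Field K] [IsAlgClosed K]
    (N s : ℕ) (hN : 1 ≤ N)
    (p : Fin s → (Fin (N + 1) → K)) (hp : ProjDistinct K p)
    (m : Fin s → ℕ) (hm : ∃ i, 0 < m i) :
    ((1 : ℝ) ≤ asympResurgence K p m ∧ asympResurgence K p m ≤ resurgence K p m) ∧
    ((alphaDeg K (fatIdeal K p m) : ℝ) / waldschmidt K p m ≤ asympResurgence K p m ∧
      asympResurgence K p m ≤ (omegaIdeal K p m : ℝ) / waldschmidt K p m) := by
  have : Infinite K := IsAlgClosed.instInfinite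
  set A := (alphaDeg K (fatIdeal K p m) : ℝ) with hA
  set W := waldschmidt K p m with hW
  set w := omegaIdeal K p m with hw
  have hW1 : 1 ≤ W := le_wald hN p hp.1 m hm
  have hWA : W ≤ A := by
    have := wald_le p m 1 one_pos
    rw [symb_one] at this
    simpa using this
  have hgen : Gen (fatIdeal K p m) w := omega_gen p m
  have hAw : A ≤ w := by
    rw [hA]
    exact_mod_cast alpha_le_of_gen hgen (by rw [← symb_one]; exact symb_ne_bot hN p hp.1 m 1)
  have hW0 : 0 < W := by linarith
  obtain ⟨c, hc⟩ := contain hN p hp m hm w hgen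
  -- lower elements
  have hlow : ∀ a r : ℕ, 0 < a → 0 < r → (a : ℝ) / r < A / W →
      ∃ T : ℕ, ∀ t : ℕ, T ≤ t → ¬ symbPow K p m (a * t) ≤ (fatIdeal K p m) ^ (r * t) :=
    fun a r ha hr h => lower hN p hp.1 m a r ha hr (by
      have hr' : (0 : ℝ) < r := by exact_mod_cast hr
      rw [div_lt_div_iff₀ hr' hW0] at h
      linarith)
  have hAW : 1 ≤ A / W := by rw [le_div_iff₀ hW0]; linarith
  let S1 : Set ℝ := {x : ℝ | ∃ a r : ℕ, 0 < a ∧ 0 < r ∧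
    (∃ T : ℕ, ∀ t : ℕ, T ≤ t → ¬ symbPow K p m (a * t) ≤ (fatIdeal K p m) ^ (r * t)) ∧
    x = (a : ℝ) / (r : ℝ)}
  let S2 : Set ℝ := {x : ℝ | ∃ a r : ℕ, 0 < a ∧ 0 < r ∧
    ¬ symbPow K p m a ≤ (fatIdeal K p m) ^ r ∧ x = (a : ℝ) / (r : ℝ)}
  have hne : S1.Nonempty := ⟨(1 : ℕ) / (2 : ℕ), 1, 2, one_pos, two_pos,
    hlow 1 2 one_pos two_pos (by push_cast; linarith), rfl⟩
  have hsub : S1 ⊆ S2 := by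
    rintro x ⟨a, r, ha, hr, ⟨T, hT⟩, rfl⟩
    refine ⟨a * (T + 1), r * (T + 1), by positivity, by positivity, hT _ (by omega), ?_⟩
    push_cast
    rw [mul_div_mul_right]
    positivity
  have hbdd : BddAbove S2 := by
    refine ⟨w + c + 1, ?_⟩
    rintro x ⟨a, r, ha, hr, h, rfl⟩
    by_contra hlt
    push Not at hlt
    apply h
    have hr' : (1 : ℝ) ≤ r := by exact_mod_cast hr
    rw [lt_div_iff₀ (by linarith)] at hlt
    have hc0 : (0 : ℝ) ≤ c := by positivity
    have hw0 : (0 : ℝ) ≤ w := by positivity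
    have ha0 : (0 : ℝ) ≤ a := by positivity
    have h1 : (r : ℝ) ≤ a := by nlinarith
    refine hc a r ha (by exact_mod_cast h1) ?_
    nlinarith
  have hbdd1 : BddAbove S1 := hbdd.mono hsub
  have hupper : asympResurgence K p m ≤ (w : ℝ) / W := by
    refine csSup_le hne ?_
    rintro x ⟨a, r, ha, hr, ⟨T, hT⟩, rfl⟩
    by_contra hlt
    push Not at hlt
    have hr' : (0 : ℝ) < r := by exact_mod_cast hr
    rw [div_lt_div_iff₀ hW0 hr'] at hlt
    obtain ⟨t, ht⟩ := exists_nat_gt ((c : ℝ) / (a * W - w * r))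
    rw [div_lt_iff₀ (by linarith)] at ht
    have hra : r ≤ a := by
      have : (r : ℝ) < a := by
        by_contra hh
        push Not at hh
        nlinarith
      exact_mod_cast this.le
    apply hT (T + t + 1) (by omega)
    refine hc _ _ (by positivity) (Nat.mul_le_mul_right _ hra) ?_
    push_cast
    have hT0 : (0 : ℝ) ≤ T := by positivity
    nlinarith [mul_nonneg hT0 (sub_nonneg.2 hlt.le)]
  have hlower : A / W ≤ asympResurgence K p m := by
    refine le_of_forall_lt fun y hy => ?_
    obtain ⟨q, hq1, hq2⟩ := exists_rat_btwn (max_lt hy (lt_of_lt_of_le one_pos hAW))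
    have hq0 : (0 : ℝ) < q := (le_max_right _ _).trans_lt hq1
    have hq0' : 0 < q := by exact_mod_cast hq0
    have hnum : 0 < q.num := Rat.num_pos.2 hq0'
    have hqe : (q : ℝ) = (q.num.toNat : ℕ) / (q.den : ℕ) := by
      rw [Rat.cast_def]
      congr 1
      have : ((q.num.toNat : ℤ) : ℝ) = (q.num : ℝ) := by rw [Int.toNat_of_nonneg hnum.le]
      rw [← this, Int.cast_natCast]
    refine ((le_max_left _ _).trans_lt hq1).trans_le (le_csSup hbdd1 ?_)
    refine ⟨q.num.toNat, q.den, by omega, q.den_pos, ?_, hqe⟩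
    exact hlow _ _ (by omega) q.den_pos (hqe ▸ hq2)
  exact ⟨⟨hAW.trans hlower, csSup_le_csSup hbdd hne hsub⟩, hlower, hupper⟩

end
end

section
/- Let Z ⊆ ℙ^N be a nonzero fat point subscheme and let M = (x_0,…,x_N) be the irrelevant maximal ideal of R = K[x_0,…,x_N]. If I(NrZ) ⊆ M^{Nr−r} I(Z)^r holds for all integers r ≥ 1, then (α(I(Z)) + N − 1)/N ≤ α̂(I(Z)). -/
open MvPolynomial

noncomputable section

attribute [local instance] MvPolynomial.gradedAlgebra

theorem hh_isHom_iff (K : Type*) [Field K] {n : ℕ} (I : Ideal (MvPolynomial (Fin n) K)) :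
    I.IsHomogeneous (homogeneousSubmodule (Fin n) K) ↔
      ∀ f ∈ I, ∀ d, homogeneousComponent d f ∈ I := by
  constructor
  · intro h f hf d
    have := h d hf
    rwa [← decomposition.decompose'_apply]
  · intro h d f hf
    have := h f hf d
    rwa [← decomposition.decompose'_apply] at this

theorem hh_eval_smul (K : Type*) [Field K] {n : ℕ} (p : Fin n → K) (t : K) (d : ℕ)
    (f : MvPolynomial (Fin n) K) (hf : f.IsHomogeneous d) :
    eval (t • p) f = t ^ d * eval p f := by
  rw [eval_eq, eval_eq, Finset.mul_sum]
  refine Finset.sum_congr rfl fun x hx => ?_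
  have hd : ∑ i ∈ x.support, x i = d := by
    have := hf (mem_support_iff.mp hx)
    rw [← Finsupp.degree_apply, Finsupp.degree_eq_weight_one]; exact this
  simp only [Pi.smul_apply, smul_eq_mul, mul_pow, Finset.prod_mul_distrib,
    Finset.prod_pow_eq_pow_sum, hd]
  ring

theorem hh_cone_hom (K : Type*) [Field K] [Infinite K] {n : ℕ} (p : Fin n → K) :
    (coneIdeal K p).IsHomogeneous (homogeneousSubmodule (Fin n) K) := by
  rw [hh_isHom_iff]
  intro f hf d t
  have hf' : ∀ t : K, eval (t • p) f = 0 := hf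
  rw [hh_eval_smul K p t d _ (homogeneousComponent_isHomogeneous d f)]
  set P : Polynomial K := ∑ e ∈ Finset.range (f.totalDegree + 1),
    Polynomial.monomial e (eval p (homogeneousComponent e f)) with hP
  have hP0 : P = 0 := by
    apply Polynomial.funext
    intro t
    rw [Polynomial.eval_zero, ← hf' t]
    conv_rhs => rw [← sum_homogeneousComponent f]
    rw [map_sum, hP, Polynomial.eval_finsetSum]
    refine Finset.sum_congr rfl fun e _ => ?_
    rw [hh_eval_smul K p t e _ (homogeneousComponent_isHomogeneous e f),
      Polynomial.eval_monomial, mul_comm]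
  have : eval p (homogeneousComponent d f) = 0 := by
    by_cases hd : d ≤ f.totalDegree
    · have h1 : P.coeff d = 0 := by rw [hP0]; simp
      rw [hP, Polynomial.finsetSum_coeff] at h1
      simp only [Polynomial.coeff_monomial] at h1
      rw [Finset.sum_ite_eq' (Finset.range (f.totalDegree + 1)) d,
        if_pos (Finset.mem_range.mpr (by omega))] at h1
      exact h1
    · rw [homogeneousComponent_eq_zero _ _ (by omega), map_zero]
  rw [this, mul_zero]

theorem hh_pow_hom (K : Type*) [Field K] {n : ℕ} (I : Ideal (MvPolynomial (Fin n) K))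
    (h : I.IsHomogeneous (homogeneousSubmodule (Fin n) K)) (k : ℕ) :
    (I ^ k).IsHomogeneous (homogeneousSubmodule (Fin n) K) := by
  induction k with
  | zero => rw [pow_zero, Ideal.one_eq_top]; exact Ideal.IsHomogeneous.top _
  | succ k ih => rw [pow_succ]; exact ih.mul h

theorem hh_fat_hom (K : Type*) [Field K] [Infinite K] {n s : ℕ} (p : Fin s → (Fin n → K))
    (m : Fin s → ℕ) : (fatIdeal K p m).IsHomogeneous (homogeneousSubmodule (Fin n) K) :=
  Ideal.IsHomogeneous.iInf fun i => hh_pow_hom K _ (hh_cone_hom K (p i)) _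

theorem hh_cone_ne (K : Type*) [Field K] {N : ℕ} (hN : 1 ≤ N) (p : Fin (N + 1) → K)
    (hp : p ≠ 0) : coneIdeal K p ≠ ⊥ := by
  obtain ⟨b, hb⟩ := Function.ne_iff.mp hp
  have : Nontrivial (Fin (N + 1)) := Fin.nontrivial_iff_two_le.mpr (by omega)
  obtain ⟨a, hab⟩ := exists_ne b
  intro h
  have hmem : (C (p b) * X a - C (p a) * X b : MvPolynomial (Fin (N + 1)) K) ∈ coneIdeal K p := by
    intro t
    simp
    ring
  rw [h, Ideal.mem_bot] at hmem
  have := congrArg (eval (Pi.single a (1 : K))) hmem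
  simp [hab.symm] at this
  exact hb this

theorem hh_fat_ne (K : Type*) [Field K] {N s : ℕ} (hN : 1 ≤ N) (p : Fin s → (Fin (N + 1) → K))
    (hp : ∀ i, p i ≠ 0) (m : Fin s → ℕ) : fatIdeal K p m ≠ ⊥ := by
  have h1 : ∏ i, (coneIdeal K (p i)) ^ (m i) ≤ fatIdeal K p m := by
    refine Ideal.prod_le_inf.trans ?_
    rw [Finset.inf_univ_eq_iInf]
    exact le_rfl
  intro h
  rw [h, le_bot_iff] at h1
  have h2 := Finset.prod_ne_zero_iff.mpr
    (fun i (_ : i ∈ Finset.univ) => pow_ne_zero (m i) (hh_cone_ne K hN (p i) (hp i)))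
  exact h2 h1

theorem hh_exists_form (K : Type*) [Field K] {n : ℕ} (I : Ideal (MvPolynomial (Fin n) K))
    (h : I.IsHomogeneous (homogeneousSubmodule (Fin n) K)) (hI : I ≠ ⊥) :
    ∃ f ∈ I, f ≠ 0 ∧ f.IsHomogeneous (alphaDeg K I) := by
  rw [hh_isHom_iff] at h
  have hne : {t : ℕ | homComp K I t ≠ ⊥}.Nonempty := by
    obtain ⟨f, hf, hf0⟩ := Submodule.exists_mem_ne_zero_of_ne_bot hI
    by_contra hcon
    apply hf0
    rw [← sum_homogeneousComponent f]
    refine Finset.sum_eq_zero fun d _ => ?_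
    have hd : homComp K I d = ⊥ := by
      by_contra hd
      exact hcon ⟨d, hd⟩
    have : homogeneousComponent d f ∈ homComp K I d :=
      ⟨h f hf d, homogeneousComponent_isHomogeneous d f⟩
    rwa [hd, Submodule.mem_bot] at this
  have := Nat.sInf_mem hne
  obtain ⟨f, hf, hf0⟩ := Submodule.exists_mem_ne_zero_of_ne_bot this
  exact ⟨f, hf.1, hf0, hf.2⟩

theorem hh_le_pow (K : Type*) [Field K] {n : ℕ} (I : Ideal (MvPolynomial (Fin n) K))
    (h : I.IsHomogeneous (homogeneousSubmodule (Fin n) K)) :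
    I ≤ idealOfVars (Fin n) K ^ (alphaDeg K I) := by
  rw [hh_isHom_iff] at h
  intro f hf
  rw [mem_pow_idealOfVars_iff]
  intro x hx
  refine Nat.sInf_le ?_
  intro hbot
  have : homogeneousComponent x.degree f ∈ homComp K I x.degree :=
    ⟨h f hf _, homogeneousComponent_isHomogeneous _ f⟩
  rw [hbot, Submodule.mem_bot] at this
  have h2 := congrArg (coeff x) this
  rw [coeff_homogeneousComponent, if_pos rfl, coeff_zero] at h2
  exact mem_support_iff.mp hx h2

set_option maxHeartbeats 1000000 in
/-- The Harbourne–Huneke containments imply Chudnovsky's bound: if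
`I(NrZ) ⊆ M^{Nr−r} I(Z)^r` for all `r ≥ 1`, where `M = (x_0, …, x_N)` is the
irrelevant maximal ideal, then `(α(I(Z)) + N − 1)/N ≤ α̂(I(Z))`. -/
theorem HH_implies_chudnovsky (K : Type*) [Field K] [IsAlgClosed K]
    (N s : ℕ) (hN : 1 ≤ N)
    (p : Fin s → (Fin (N + 1) → K)) (hp : ProjDistinct K p)
    (m : Fin s → ℕ) (hm : ∃ i, 0 < m i)
    (H : ∀ r : ℕ, 1 ≤ r →
      symbPow K p m (N * r) ≤
        (Ideal.span (Set.range (X : Fin (N + 1) → MvPolynomial (Fin (N + 1)) K)))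
            ^ (N * r - r) * (fatIdeal K p m) ^ r) :
    ((alphaDeg K (fatIdeal K p m) : ℝ) + (N : ℝ) - 1) / (N : ℝ)
      ≤ waldschmidt K p m := by
  have : Infinite K := IsAlgClosed.instInfinite
  have hN0 : (0 : ℝ) < N := by exact_mod_cast hN
  refine le_ciInf fun k => ?_
  have hk : 1 ≤ (k : ℕ) := k.2
  have hk0 : (0 : ℝ) < ((k : ℕ) : ℝ) := by exact_mod_cast hk
  obtain ⟨F, hF, hF0, hFh⟩ := hh_exists_form K (symbPow K p m k) (hh_fat_hom K p _)
    (hh_fat_ne K hN p hp.1 _)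
  set t := alphaDeg K (symbPow K p m k)
  set a := alphaDeg K (fatIdeal K p m)
  have h1 : F ^ N ∈ symbPow K p m (N * k) := by
    unfold symbPow fatIdeal at hF ⊢
    rw [Ideal.mem_iInf] at hF ⊢
    intro i
    have := Ideal.pow_mem_pow (hF i) N
    rwa [← pow_mul, show (k : ℕ) * m i * N = N * k * m i by ring] at this
  have h2 := H k hk h1
  have h3 : F ^ N ∈ idealOfVars (Fin (N + 1)) K ^ ((N * k - k) + a * k) := by
    rw [pow_add, pow_mul]
    exact Ideal.mul_mono le_rfl (Ideal.pow_right_mono (hh_le_pow K _ (hh_fat_hom K p m)) k) h2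
  rw [mem_pow_idealOfVars_iff] at h3
  obtain ⟨x, hx⟩ := support_nonempty.mpr (pow_ne_zero N hF0)
  have h4 := h3 x hx
  have h5 : x.degree = t * N := by
    have := (hFh.pow N) (mem_support_iff.mp hx)
    rw [Finsupp.degree_eq_weight_one]; exact this
  rw [h5] at h4
  have h6 : N * (k : ℕ) + a * k ≤ t * N + k := by omega
  have h7 : (N : ℝ) * ((k : ℕ) : ℝ) + a * ((k : ℕ) : ℝ) ≤ t * N + ((k : ℕ) : ℝ) := by
    exact_mod_cast h6
  rw [div_le_div_iff₀ hN0 hk0]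
  nlinarith

end
end

section
/- Let Z = p_1+⋯+p_s be a reduced scheme of s distinct points in ℙ² over an algebraically closed field K and let I = I(Z). Then (α(I) + 1)/2 ≤ α̂(I) (Chudnovsky's theorem for points in the plane). -/
open MvPolynomial

noncomputable section

lemma chud_span {K : Type*} [Field K] (t α : ℕ) (c : K) (hc : c ≠ 0)
    (r h : MvPolynomial (Fin 2) K)
    (hr : r ∈ Submodule.span K {u : MvPolynomial (Fin 2) K |
      ∃ a b : ℕ, a < t ∧ a + b ≤ t ∧ u = X 0 ^ a * X 1 ^ b})
    (hh : h ∈ Submodule.span K {u : MvPolynomial (Fin 2) K |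
      ∃ a b : ℕ, a + b < α ∧ u = X 0 ^ a * X 1 ^ b})
    (I : Ideal (MvPolynomial (Fin 2) K))
    (hf : C c * X 0 ^ t + r ∈ I) (hg : X 1 ^ α - h ∈ I) :
    Module.Finite K (MvPolynomial (Fin 2) K ⧸ I) ∧
      Module.finrank K (MvPolynomial (Fin 2) K ⧸ I) ≤ t * α := by
  let π : MvPolynomial (Fin 2) K →ₗ[K] MvPolynomial (Fin 2) K ⧸ I := (Ideal.Quotient.mkₐ K I).toLinearMap
  have hπ : ∀ u v : MvPolynomial (Fin 2) K, u - v ∈ I → π u = π v := fun u v huv => Ideal.Quotient.eq.mpr huv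
  let w : Fin t × Fin α → MvPolynomial (Fin 2) K ⧸ I := fun ij => π (X 0 ^ (ij.1 : ℕ) * X 1 ^ (ij.2 : ℕ))
  let N : Submodule K (MvPolynomial (Fin 2) K ⧸ I) := Submodule.span K (Set.range w)
  have key : ∀ d : ℕ, ∀ i j : ℕ, i + j = d → π (X 0 ^ i * X 1 ^ j) ∈ N := by
    intro d
    induction d using Nat.strong_induction_on with
    | _ d ihd =>
    intro i
    induction i using Nat.strong_induction_on with
    | _ i ihi =>
    intro j hij
    by_cases hj : j < α
    · by_cases hi : i < t
      · exact Submodule.subset_span ⟨(⟨i, hi⟩, ⟨j, hj⟩), rfl⟩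
      · push Not at hi
        have e1 : π (X 0 ^ i * X 1 ^ j) = π ((-c⁻¹) • (X 0 ^ (i - t) * X 1 ^ j * r)) := by
          apply hπ
          have : (X 0 ^ i * X 1 ^ j - (-c⁻¹) • (X 0 ^ (i - t) * X 1 ^ j * r) : MvPolynomial (Fin 2) K)
              = (C c⁻¹ * X 0 ^ (i - t) * X 1 ^ j) * (C c * X 0 ^ t + r) := by
            have h1 : (X 0 ^ i : MvPolynomial (Fin 2) K) = X 0 ^ (i - t) * X 0 ^ t := by
              rw [← pow_add]; congr 1; omega
            have h2 : (C c⁻¹ * C c : MvPolynomial (Fin 2) K) = 1 := by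
              rw [← C_mul, inv_mul_cancel₀ hc, C_1]
            rw [h1, smul_eq_C_mul, C_neg]
            linear_combination (-X 0 ^ (i - t) * X 0 ^ t * X 1 ^ j : MvPolynomial (Fin 2) K) * h2
          rw [this]
          exact I.mul_mem_left _ hf
        rw [e1, map_smul]
        apply N.smul_mem
        refine Submodule.span_induction (p := fun u _ => π (X 0 ^ (i - t) * X 1 ^ j * u) ∈ N)
          ?_ ?_ ?_ ?_ hr
        · rintro _ ⟨a, b, ha, hab, rfl⟩
          have e2 : (X 0 ^ (i - t) * X 1 ^ j * (X 0 ^ a * X 1 ^ b) : MvPolynomial (Fin 2) K)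
              = X 0 ^ (i - t + a) * X 1 ^ (j + b) := by ring
          rw [e2]
          by_cases hlt : a + b < t
          · exact ihd (i - t + a + (j + b)) (by omega) _ _ rfl
          · exact ihi (i - t + a) (by omega) _ (by omega)
        · simp
        · intro x y _ _ hx hy
          rw [mul_add, map_add]; exact N.add_mem hx hy
        · intro a x _ hx
          rw [mul_smul_comm, map_smul]; exact N.smul_mem _ hx
    · push Not at hj
      have e1 : π (X 0 ^ i * X 1 ^ j) = π (X 0 ^ i * X 1 ^ (j - α) * h) := by
        apply hπ
        have : (X 0 ^ i * X 1 ^ j - X 0 ^ i * X 1 ^ (j - α) * h : MvPolynomial (Fin 2) K)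
            = (X 0 ^ i * X 1 ^ (j - α)) * (X 1 ^ α - h) := by
          have h1 : (X 1 ^ j : MvPolynomial (Fin 2) K) = X 1 ^ (j - α) * X 1 ^ α := by
            rw [← pow_add]; congr 1; omega
          rw [h1]; ring
        rw [this]
        exact I.mul_mem_left _ hg
      rw [e1]
      refine Submodule.span_induction (p := fun u _ => π (X 0 ^ i * X 1 ^ (j - α) * u) ∈ N)
        ?_ ?_ ?_ ?_ hh
      · rintro _ ⟨a, b, hab, rfl⟩
        have e2 : (X 0 ^ i * X 1 ^ (j - α) * (X 0 ^ a * X 1 ^ b) : MvPolynomial (Fin 2) K)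
            = X 0 ^ (i + a) * X 1 ^ (j - α + b) := by ring
        rw [e2]
        exact ihd (i + a + (j - α + b)) (by omega) _ _ rfl
      · simp
      · intro x y _ _ hx hy
        rw [mul_add, map_add]; exact N.add_mem hx hy
      · intro a x _ hx
        rw [mul_smul_comm, map_smul]; exact N.smul_mem _ hx
  have htop : N = ⊤ := by
    rw [eq_top_iff]
    rintro x -
    obtain ⟨u, rfl⟩ := Ideal.Quotient.mk_surjective x
    change π u ∈ N
    rw [u.as_sum, map_sum]
    refine N.sum_mem fun m _ => ?_
    rw [monomial_eq, ← smul_eq_C_mul, map_smul]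
    apply N.smul_mem
    rw [Finsupp.prod_fintype _ _ (by simp), Fin.prod_univ_two]
    exact key _ _ _ rfl
  have hfin : Module.Finite K (MvPolynomial (Fin 2) K ⧸ I) := by
    refine ⟨htop ▸ Submodule.fg_span (Set.finite_range w)⟩
  refine ⟨hfin, ?_⟩
  have := finrank_range_le_card (R := K) w
  rw [Set.finrank] at this
  change Module.finrank K N ≤ _ at this
  rw [htop, finrank_top] at this
  simpa using this

lemma chud_local {K : Type*} [Field K] (k : ℕ) (P : Fin 2 → K)
    (g : MvPolynomial (Fin 2) K) (hg : g ∈ RingHom.ker (eval P))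
    (J : Ideal (MvPolynomial (Fin 2) K)) (hJ : J = RingHom.ker (eval P) ^ k ⊔ Ideal.span {g})
    [Module.Finite K (MvPolynomial (Fin 2) K ⧸ J)] :
    k ≤ Module.finrank K (MvPolynomial (Fin 2) K ⧸ J) := by
  rcases Nat.eq_zero_or_pos k with rfl | hk
  · simp
  let m : Ideal (MvPolynomial (Fin 2) K) := RingHom.ker (eval P)
  have hX : ∀ i, (X i - C (P i) : MvPolynomial (Fin 2) K) ∈ m := fun i => by simp [m, RingHom.mem_ker]
  have hpow : ∀ i : Fin 2, ∃ r : MvPolynomial (Fin 2) K, (X i - C (P i) : MvPolynomial (Fin 2) K) ^ k = X i ^ k + r ∧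
      r ∈ Submodule.span K {u : MvPolynomial (Fin 2) K | ∃ a : ℕ, a < k ∧ u = X i ^ a} := by
    intro i
    refine ⟨∑ a ∈ Finset.range k,
      X i ^ a * (-C (P i)) ^ (k - a) * ((k.choose a : ℕ) : MvPolynomial (Fin 2) K), ?_, ?_⟩
    · rw [sub_eq_add_neg, add_pow, Finset.sum_range_succ, add_comm]
      simp only [Nat.sub_self, pow_zero, Nat.choose_self, Nat.cast_one, mul_one]
    · refine Submodule.sum_mem _ fun a ha => ?_
      have : (X i ^ a * (-C (P i)) ^ (k - a) * ((k.choose a : ℕ) : MvPolynomial (Fin 2) K))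
          = ((-P i) ^ (k - a) * ((k.choose a : ℕ) : K)) • X i ^ a := by
        rw [smul_eq_C_mul]; simp; ring
      rw [this]
      exact Submodule.smul_mem _ _ (Submodule.subset_span ⟨a, by simpa using ha, rfl⟩)
  have hQ : Module.Finite K (MvPolynomial (Fin 2) K ⧸ m ^ k) := by
    obtain ⟨r0, e0, h0⟩ := hpow 0
    obtain ⟨r1, e1, h1⟩ := hpow 1
    refine (chud_span k k (1 : K) one_ne_zero r0 (-r1) ?_ ?_ (m ^ k) ?_ ?_).1
    · refine Submodule.span_mono ?_ h0
      rintro _ ⟨a, ha, rfl⟩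
      exact ⟨a, 0, ha, by omega, by simp⟩
    · refine Submodule.neg_mem _ (Submodule.span_mono ?_ h1)
      rintro _ ⟨a, ha, rfl⟩
      exact ⟨0, a, by omega, by simp⟩
    · rw [C_1, one_mul, ← e0]; exact Ideal.pow_mem_pow (hX 0) k
    · rw [sub_neg_eq_add, ← e1]; exact Ideal.pow_mem_pow (hX 1) k
  let μ : (MvPolynomial (Fin 2) K ⧸ m ^ k) →ₗ[K] (MvPolynomial (Fin 2) K ⧸ m ^ k) := LinearMap.mulLeft K (Ideal.Quotient.mk (m ^ k) g)
  let v : Fin k → MvPolynomial (Fin 2) K := fun i => (X 0 - C (P 0)) ^ (i : ℕ) * (X 1 - C (P 1)) ^ (k - 1 - (i : ℕ))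
  have hv : ∀ i, g * v i ∈ m ^ k := by
    intro i
    have h1 : v i ∈ m ^ (k - 1) := by
      have := Ideal.mul_mem_mul (Ideal.pow_mem_pow (hX 0) (i : ℕ))
        (Ideal.pow_mem_pow (hX 1) (k - 1 - (i : ℕ)))
      rw [← pow_add] at this
      have e : (i : ℕ) + (k - 1 - (i : ℕ)) = k - 1 := by omega
      rw [e] at this
      exact this
    have h2 := Ideal.mul_mem_mul hg h1
    change g * v i ∈ m * m ^ (k - 1) at h2
    rw [← pow_succ'] at h2
    rwa [Nat.sub_add_cancel hk] at h2
  have hker : ∀ i, Ideal.Quotient.mk (m ^ k) (v i) ∈ LinearMap.ker μ := by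
    intro i
    rw [LinearMap.mem_ker]
    change Ideal.Quotient.mk (m ^ k) g * Ideal.Quotient.mk (m ^ k) (v i) = 0
    rw [← map_mul]
    exact Ideal.Quotient.eq_zero_iff_mem.mpr (hv i)
  let τ : MvPolynomial (Fin 2) K →ₐ[K] MvPolynomial (Fin 2) K := aeval (fun i => X i + C (P i))
  have hτm : m ≤ (idealOfVars (Fin 2) K).comap τ := by
    intro u hu
    rw [Ideal.mem_comap]
    rw [← pow_one (idealOfVars (Fin 2) K), mem_pow_idealOfVars_iff']
    intro x hx
    have hx0 : x = 0 := by
      rw [← Finsupp.degree_eq_zero_iff]; omega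
    subst hx0
    have h1 : eval (0 : Fin 2 → K) (τ u) = eval P u := by
      simp only [τ]
      rw [aeval_def, ← coe_eval₂Hom]
      change ((eval (0 : Fin 2 → K)).comp (eval₂Hom (algebraMap K (MvPolynomial (Fin 2) K)) _)) u = _
      congr 1
      ext i <;> simp
    have h2 : coeff 0 (τ u) = eval (0 : Fin 2 → K) (τ u) := by
      change constantCoeff (τ u) = _
      rw [constantCoeff_eq, ← constantCoeff_eq]
      have : (eval (0 : Fin 2 → K)) = (constantCoeff : MvPolynomial (Fin 2) K →+* K) := by
        ext i <;> simp
      rw [this]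
    rw [h2, h1]; exact hu
  have hτ : ∀ u ∈ m ^ k, τ u ∈ idealOfVars (Fin 2) K ^ k := by
    intro u hu
    have := Ideal.pow_right_mono hτm k hu
    exact (Ideal.le_comap_pow (K := idealOfVars (Fin 2) K) τ k) this
  have hli : LinearIndependent K (fun i : Fin k => (⟨_, hker i⟩ : LinearMap.ker μ)) := by
    rw [Fintype.linearIndependent_iff]
    intro c hc i
    have h1 : ∑ i, c i • v i ∈ m ^ k := by
      rw [← Ideal.Quotient.eq_zero_iff_mem]
      have := congrArg Subtype.val hc
      simp only [Submodule.coe_sum, Submodule.coe_smul, Submodule.coe_zero] at this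
      rw [map_sum, ← this]
      rfl
    have h2 := hτ _ h1
    rw [mem_pow_idealOfVars_iff'] at h2
    let x : Fin k → (Fin 2 →₀ ℕ) := fun i =>
      Finsupp.single 0 (i : ℕ) + Finsupp.single 1 (k - 1 - (i : ℕ))
    have hτv : ∀ j, τ (v j) = monomial (x j) 1 := by
      intro j
      simp [τ, v, x, X_pow_eq_monomial, monomial_mul, -Finsupp.single_tsub]
    have h3 := h2 (x i) (by
      simp only [x, map_add, Finsupp.degree_single]; omega)
    rw [map_sum] at h3
    simp only [map_smul, hτv, coeff_sum, coeff_smul, coeff_monomial] at h3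
    have hinj : ∀ j, x j = x i ↔ j = i := by
      intro j
      constructor
      · intro h
        have := DFunLike.congr_fun h 0
        simp [x] at this
        exact Fin.ext this
      · rintro rfl; rfl
    simpa [hinj] using h3
  have hk1 : k ≤ Module.finrank K (LinearMap.ker μ) := by
    simpa using hli.fintype_card_le_finrank
  have hcok : Module.finrank K ((MvPolynomial (Fin 2) K ⧸ m ^ k) ⧸ LinearMap.range μ)
      = Module.finrank K (LinearMap.ker μ) := by
    have a1 := Submodule.finrank_quotient_add_finrank (LinearMap.range μ)
    have a2 := LinearMap.finrank_range_add_finrank_ker μ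
    omega
  let q : MvPolynomial (Fin 2) K →ₗ[K] ((MvPolynomial (Fin 2) K ⧸ m ^ k) ⧸ LinearMap.range μ) :=
    (LinearMap.range μ).mkQ ∘ₗ (Ideal.Quotient.mkₐ K (m ^ k)).toLinearMap
  have hq : Function.Surjective q :=
    (Submodule.mkQ_surjective _).comp Ideal.Quotient.mk_surjective
  have hJq : J.restrictScalars K ≤ LinearMap.ker q := by
    intro u hu
    rw [Submodule.restrictScalars_mem, hJ, Submodule.mem_sup] at hu
    obtain ⟨a, ha, b, hb, rfl⟩ := hu
    obtain ⟨d, rfl⟩ := Ideal.mem_span_singleton'.mp hb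
    rw [LinearMap.mem_ker, map_add]
    have ea : q a = 0 := by
      change (LinearMap.range μ).mkQ (Ideal.Quotient.mk (m ^ k) a) = 0
      rw [Ideal.Quotient.eq_zero_iff_mem.mpr ha, map_zero]
    have eb : q (d * g) = 0 := by
      change (LinearMap.range μ).mkQ (Ideal.Quotient.mk (m ^ k) (d * g)) = 0
      rw [Submodule.mkQ_apply, Submodule.Quotient.mk_eq_zero]
      refine ⟨Ideal.Quotient.mk (m ^ k) d, ?_⟩
      change Ideal.Quotient.mk (m ^ k) g * Ideal.Quotient.mk (m ^ k) d = _
      rw [← map_mul, mul_comm]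
    rw [ea, eb, add_zero]
  let q' : (MvPolynomial (Fin 2) K ⧸ J.restrictScalars K) →ₗ[K] ((MvPolynomial (Fin 2) K ⧸ m ^ k) ⧸ LinearMap.range μ) :=
    (J.restrictScalars K).liftQ q hJq
  have hq' : Function.Surjective q' := by
    intro y
    obtain ⟨u, rfl⟩ := hq y
    exact ⟨Submodule.Quotient.mk u, rfl⟩
  let e := Submodule.Quotient.restrictScalarsEquiv K J
  have hfin : Module.Finite K (MvPolynomial (Fin 2) K ⧸ J) := inferInstance
  have := LinearMap.finrank_le_finrank_of_surjective
    (f := q' ∘ₗ e.symm.toLinearMap) (hq'.comp e.symm.surjective)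
  omega

lemma chud_bezout {K : Type*} [Field K] {κ : Type*} [Fintype κ] (P : κ → Fin 2 → K)
    (hP : Function.Injective P) (k t α : ℕ) (c : K) (hc : c ≠ 0)
    (r h : MvPolynomial (Fin 2) K)
    (hr : r ∈ Submodule.span K {u : MvPolynomial (Fin 2) K |
      ∃ a b : ℕ, a < t ∧ a + b ≤ t ∧ u = X 0 ^ a * X 1 ^ b})
    (hh : h ∈ Submodule.span K {u : MvPolynomial (Fin 2) K |
      ∃ a b : ℕ, a + b < α ∧ u = X 0 ^ a * X 1 ^ b})
    (hf : ∀ j, C c * X 0 ^ t + r ∈ RingHom.ker (eval (P j)) ^ k)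
    (hg : ∀ j, X 1 ^ α - h ∈ RingHom.ker (eval (P j))) :
    Fintype.card κ * k ≤ t * α := by
  let J : κ → Ideal (MvPolynomial (Fin 2) K) := fun j =>
    RingHom.ker (eval (P j)) ^ k ⊔ Ideal.span {X 1 ^ α - h}
  have hfJ : ∀ j, C c * X 0 ^ t + r ∈ J j := fun j => (le_sup_left : _ ≤ J j) (hf j)
  have hgJ : ∀ j, X 1 ^ α - h ∈ J j := fun j =>
    (le_sup_right : _ ≤ J j) (Ideal.mem_span_singleton_self _)
  have hmax : ∀ j, (RingHom.ker (eval (P j))).IsMaximal := fun j =>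
    RingHom.ker_isMaximal_of_surjective _ (fun x => ⟨C x, by simp⟩)
  have hcop : Pairwise (Function.onFun IsCoprime J) := by
    intro i j hij
    have hne : RingHom.ker (eval (P i)) ≠ RingHom.ker (eval (P j)) := by
      intro he
      apply hij
      apply hP
      funext l
      have h1 : (X l - C (P i l) : MvPolynomial (Fin 2) K) ∈ RingHom.ker (eval (P i)) := by
        simp [RingHom.mem_ker]
      rw [he] at h1
      simp [RingHom.mem_ker, sub_eq_zero] at h1
      exact h1.symm
    have h1 : IsCoprime (RingHom.ker (eval (P i))) (RingHom.ker (eval (P j))) :=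
      Ideal.isCoprime_iff_sup_eq.mpr ((hmax i).coprime_of_ne (hmax j) hne)
    have h2 := (IsCoprime.pow (m := k) (n := k) h1)
    rw [Ideal.isCoprime_iff_sup_eq] at h2
    change IsCoprime (J i) (J j)
    rw [Ideal.isCoprime_iff_sup_eq, eq_top_iff, ← h2]
    exact sup_le_sup le_sup_left le_sup_left
  let I : Ideal (MvPolynomial (Fin 2) K) := ⨅ j, J j
  obtain ⟨hfin, hle⟩ := chud_span t α c hc r h hr hh I
    (by simpa [I, Ideal.mem_iInf] using hfJ) (by simpa [I, Ideal.mem_iInf] using hgJ)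
  have hfinJ : ∀ j, Module.Finite K (MvPolynomial (Fin 2) K ⧸ J j) := fun j =>
    (chud_span t α c hc r h hr hh (J j) (hfJ j) (hgJ j)).1
  let ψ : (MvPolynomial (Fin 2) K ⧸ I) →ₐ[K] (∀ j, MvPolynomial (Fin 2) K ⧸ J j) :=
    Ideal.Quotient.liftₐ I (AlgHom.pi fun j => Ideal.Quotient.mkₐ K (J j)) (by
      intro a ha
      funext j
      exact Ideal.Quotient.eq_zero_iff_mem.mpr ((Ideal.mem_iInf.mp ha) j))
  have hψ : Function.Surjective ψ := by
    intro y
    obtain ⟨x, hx⟩ := Ideal.pi_quotient_surjective hcop y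
    refine ⟨Ideal.Quotient.mk I x, ?_⟩
    funext j
    exact hx j
  have h1 := LinearMap.finrank_le_finrank_of_surjective (f := ψ.toLinearMap) hψ
  rw [Module.finrank_pi_fintype] at h1
  have h2 : ∑ _j : κ, k ≤ ∑ j, Module.finrank K (MvPolynomial (Fin 2) K ⧸ J j) :=
    Finset.sum_le_sum fun j _ => chud_local k (P j) _ (hg j) (J j) rfl
  simp only [Finset.sum_const, Finset.card_univ, smul_eq_mul] at h2
  omega

lemma chud_select {K V : Type*} {ι : Type} [Field K] [AddCommGroup V] [Module K V]
    [Module.Finite K V]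
    (ev : ι → Module.Dual K V) (hinj : ∀ w, (∀ i, ev i w = 0) → w = 0) :
    ∃ (κ : Type) (_ : Fintype κ) (a : κ → ι), Function.Injective a ∧
      Module.finrank K V = Fintype.card κ ∧ ∀ y : κ → K, ∃ w, ∀ j, ev (a j) w = y j := by
  obtain ⟨κ, a, ha, hsp, hli⟩ := exists_linearIndependent' K ev
  have hfinκ : Finite κ := hli.finite
  have : Fintype κ := Fintype.ofFinite κ
  let L : V →ₗ[K] (κ → K) := LinearMap.pi fun j => ev (a j)
  have hL : Function.Injective L := by
    rw [← LinearMap.ker_eq_bot, LinearMap.ker_eq_bot']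
    intro w hw
    apply hinj
    have h1 : ∀ φ ∈ Submodule.span K (Set.range (ev ∘ a)), φ w = 0 := by
      intro φ hφ
      refine Submodule.span_induction (p := fun φ _ => φ w = 0) ?_ ?_ ?_ ?_ hφ
      · rintro _ ⟨j, rfl⟩
        exact congrFun hw j
      · simp
      · intro x y _ _ hx hy; simp [hx, hy]
      · intro b x _ hx; simp [hx]
    intro i
    apply h1
    rw [hsp]
    exact Submodule.subset_span ⟨i, rfl⟩
  have c1 : Fintype.card κ ≤ Module.finrank K V := by
    rw [← Subspace.dual_finrank_eq]
    exact hli.fintype_card_le_finrank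
  have c2 : Module.finrank K V ≤ Fintype.card κ := by
    simpa using LinearMap.finrank_le_finrank_of_injective hL
  have c3 : Module.finrank K V = Fintype.card κ := le_antisymm c2 c1
  refine ⟨κ, this, a, ha, c3, ?_⟩
  have hs : Function.Surjective L :=
    (LinearMap.injective_iff_surjective_of_finrank_eq_finrank (by simpa using c3)).mp hL
  intro y
  obtain ⟨w, hw⟩ := hs y
  exact ⟨w, fun j => congrFun hw j⟩

lemma chud_finrank (K : Type*) [Field K] (α : ℕ) :
    Module.Finite K (Submodule.span K {u : MvPolynomial (Fin 2) K |
      ∃ a b : ℕ, a + b < α ∧ u = X 0 ^ a * X 1 ^ b}) ∧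
    Module.finrank K (Submodule.span K {u : MvPolynomial (Fin 2) K |
      ∃ a b : ℕ, a + b < α ∧ u = X 0 ^ a * X 1 ^ b}) * 2 = α * (α + 1) := by
  let x : (Σ i : Fin α, Fin ((i : ℕ) + 1)) → (Fin 2 →₀ ℕ) := fun τ =>
    Finsupp.single 0 (τ.2 : ℕ) + Finsupp.single 1 ((τ.1 : ℕ) - (τ.2 : ℕ))
  have hx : Function.Injective x := by
    rintro ⟨⟨i, hi⟩, ⟨j, hj⟩⟩ ⟨⟨i', hi'⟩, ⟨j', hj'⟩⟩ h
    have h0 := DFunLike.congr_fun h 0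
    have h1 := DFunLike.congr_fun h 1
    simp only [x, Finsupp.add_apply, Finsupp.single_apply] at h0 h1
    simp at h0 h1 hj hj'
    obtain rfl : i = i' := by omega
    subst h0
    rfl
  let v : (Σ i : Fin α, Fin ((i : ℕ) + 1)) → MvPolynomial (Fin 2) K := fun τ => monomial (x τ) 1
  have hv : LinearIndependent K v := by
    have := (basisMonomials (Fin 2) K).linearIndependent.comp x hx
    simpa [Function.comp_def] using this
  have hset : {u : MvPolynomial (Fin 2) K |
      ∃ a b : ℕ, a + b < α ∧ u = X 0 ^ a * X 1 ^ b} = Set.range v := by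
    ext u
    constructor
    · rintro ⟨a, b, hab, rfl⟩
      refine ⟨⟨⟨a + b, hab⟩, ⟨a, by simp⟩⟩, ?_⟩
      simp [v, x, X_pow_eq_monomial, monomial_mul]
    · rintro ⟨⟨⟨i, hi⟩, ⟨j, hj⟩⟩, rfl⟩
      simp at hj
      refine ⟨j, i - j, by omega, ?_⟩
      simp [v, x, X_pow_eq_monomial, monomial_mul, -Finsupp.single_tsub]
  rw [hset]
  refine ⟨Module.Finite.span_of_finite K (Set.finite_range v), ?_⟩
  rw [finrank_span_eq_card hv]
  simp only [Fintype.card_sigma, Fintype.card_fin]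
  rw [Fin.sum_univ_eq_sum_range (fun i => i + 1) α]
  clear * -
  induction α with
  | zero => simp
  | succ n ih => rw [Finset.sum_range_succ, add_mul, ih]; ring

lemma chud_aff {K : Type*} [Field K] {ι : Type} (P : ι → Fin 2 → K)
    (hP : Function.Injective P) (k t α : ℕ) (hα : 0 < α) (c : K) (hc : c ≠ 0)
    (r : MvPolynomial (Fin 2) K)
    (hr : r ∈ Submodule.span K {u : MvPolynomial (Fin 2) K |
      ∃ a b : ℕ, a < t ∧ a + b ≤ t ∧ u = X 0 ^ a * X 1 ^ b})
    (hf : ∀ j, C c * X 0 ^ t + r ∈ RingHom.ker (eval (P j)) ^ k)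
    (hinj : ∀ h ∈ Submodule.span K {u : MvPolynomial (Fin 2) K |
      ∃ a b : ℕ, a + b < α ∧ u = X 0 ^ a * X 1 ^ b}, (∀ i, eval (P i) h = 0) → h = 0) :
    k * (α + 1) ≤ 2 * t := by
  obtain ⟨hfin, hrank⟩ := chud_finrank K α
  let D := Submodule.span K {u : MvPolynomial (Fin 2) K |
      ∃ a b : ℕ, a + b < α ∧ u = X 0 ^ a * X 1 ^ b}
  obtain ⟨κ, _, a, ha, hcard, hsurj⟩ := chud_select (V := D)
    (fun i => (aeval (P i) : MvPolynomial (Fin 2) K →ₐ[K] K).toLinearMap ∘ₗ D.subtype) (by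
      rintro ⟨w, hw⟩ hz
      have := hinj w hw (fun i => by simpa [aeval_eq_eval] using hz i)
      simpa using this)
  obtain ⟨⟨h, hh⟩, hh2⟩ := hsurj (fun j => P (a j) 1 ^ α)
  have := chud_bezout (fun j => P (a j)) (hP.comp ha) k t α c hc r h hr hh (fun j => hf _) (by
    intro j
    have := hh2 j
    simp [aeval_eq_eval] at this
    simp [RingHom.mem_ker, this])
  rw [← hcard] at this
  have h3 : (k * (α + 1)) * α ≤ (2 * t) * α := by nlinarith
  exact Nat.le_of_mul_le_mul_right h3 hα

lemma chud_equiv {K : Type*} [Field K] [Infinite K] {s : ℕ} (hs : 0 < s)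
    (p : Fin s → Fin 3 → K) (q : Fin 3 → K) (hq : q ≠ 0) (hpq : ∀ i, ∀ c : K, p i ≠ c • q) :
    ∃ E : (Fin 3 → K) ≃ₗ[K] (Fin 3 → K), E q = ![1, 0, 0] ∧ ∀ i, E (p i) 2 ≠ 0 := by
  obtain ⟨f, hf⟩ := Module.exists_dual_forall_apply_ne_zero (K := K)
    (fun i => (Submodule.span K {q}).mkQ (p i)) (by
      intro i h
      rw [Submodule.mkQ_apply, Submodule.Quotient.mk_eq_zero, Submodule.mem_span_singleton] at h
      obtain ⟨c, hc⟩ := h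
      exact hpq i c hc.symm)
  let l : (Fin 3 → K) →ₗ[K] K := f ∘ₗ (Submodule.span K {q}).mkQ
  have hlp : ∀ i, l (p i) ≠ 0 := hf
  have hlq : l q = 0 := by
    change f ((Submodule.span K {q}).mkQ q) = 0
    rw [Submodule.mkQ_apply,
      (Submodule.Quotient.mk_eq_zero _).mpr (Submodule.mem_span_singleton_self q), map_zero]
  let i0 : Fin s := ⟨0, hs⟩
  let e2 : Fin 3 → K := (l (p i0))⁻¹ • p i0
  have hle2 : l e2 = 1 := by simp [e2, hlp i0]
  obtain ⟨e, he⟩ : ∃ e, e ∉ Submodule.span K (Set.range ![q, e2]) := by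
    by_contra! hcon
    have h1 : Submodule.span K (Set.range ![q, e2]) = ⊤ := by
      rw [eq_top_iff]; exact fun x _ => hcon x
    have h2 := finrank_range_le_card (R := K) ![q, e2]
    rw [Set.finrank, h1, finrank_top] at h2
    simp at h2
  let e1 := e - l e • e2
  have hle1 : l e1 = 0 := by simp [e1, hle2]
  let v : Fin 3 → Fin 3 → K := ![q, e1, e2]
  have hv : LinearIndependent K v := by
    rw [Fintype.linearIndependent_iff]
    intro g hg
    rw [Fin.sum_univ_three] at hg
    simp only [v, Matrix.cons_val] at hg
    have g2 : g 2 = 0 := by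
      have := congrArg l hg
      simpa [hlq, hle1, hle2] using this
    have g1 : g 1 = 0 := by
      by_contra hne
      apply he
      have : e = (-(g 1)⁻¹ * g 0) • q + (l e) • e2 := by
        have h3 : g 1 • e1 = - g 0 • q := by
          rw [g2, zero_smul, add_zero] at hg
          rw [neg_smul]; exact eq_neg_of_add_eq_zero_right hg
        have h4 : e1 = (-(g 1)⁻¹ * g 0) • q := by
          calc e1 = (g 1)⁻¹ • (g 1 • e1) := by rw [smul_smul, inv_mul_cancel₀ hne, one_smul]
            _ = _ := by rw [h3, smul_smul]; congr 1; ring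
        rw [← h4]; simp [e1]
      rw [this]
      exact Submodule.add_mem _
        (Submodule.smul_mem _ _ (Submodule.subset_span ⟨0, rfl⟩))
        (Submodule.smul_mem _ _ (Submodule.subset_span ⟨1, rfl⟩))
    have g0 : g 0 = 0 := by
      simpa [g1, g2, hq] using hg
    intro i
    fin_cases i
    · exact g0
    · exact g1
    · exact g2
  let b := basisOfLinearIndependentOfCardEqFinrank hv (by simp)
  have hb : ∀ i, b i = v i := fun i => by simp [b]
  refine ⟨b.equivFun, ?_, ?_⟩
  · have : q = b 0 := by rw [hb]; rfl
    conv_lhs => rw [this]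
    funext i
    rw [Module.Basis.equivFun_self]
    fin_cases i <;> simp
  · intro i
    have h1 : ∀ x, l x = b.equivFun x 2 := by
      intro x
      conv_lhs => rw [← b.sum_equivFun x]
      rw [Fin.sum_univ_three, hb, hb, hb]
      simp [v, hlq, hle1, hle2]
    rw [← h1]; exact hlp i

lemma chud_dehom {K : Type*} [Field K] (t : ℕ) (G : MvPolynomial (Fin 3) K)
    (hG : G.IsHomogeneous t) (hG1 : eval ![1, 0, 0] G ≠ 0) :
    ∃ c : K, c ≠ 0 ∧ ∃ r ∈ Submodule.span K {u : MvPolynomial (Fin 2) K |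
      ∃ a b : ℕ, a < t ∧ a + b ≤ t ∧ u = X 0 ^ a * X 1 ^ b},
      aeval ![(X 0 : MvPolynomial (Fin 2) K), X 1, 1] G = C c * X 0 ^ t + r := by
  have hdeg : ∀ u ∈ G.support, u 0 + u 1 + u 2 = t := by
    intro u hu
    have := hG.degree_eq_sum_deg_support hu
    rw [this, ← Finsupp.degree_apply, Finsupp.degree_eq_sum, Fin.sum_univ_three]
  have hne : ∀ u ∈ G.support, u ≠ Finsupp.single 0 t → u 0 < t := by
    intro u hu h
    have h1 := hdeg u hu
    by_contra hlt
    apply h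
    ext i
    fin_cases i
    · simp; omega
    · simp; omega
    · simp; omega
  have hc : eval ![1, 0, 0] G = coeff (Finsupp.single 0 t) G := by
    rw [eval_eq']
    rw [Finset.sum_eq_single (Finsupp.single 0 t)]
    · simp [Fin.prod_univ_three]
    · intro u hu h
      have h1 := hdeg u hu
      have h2 := hne u hu h
      rw [Fin.prod_univ_three]
      rcases Nat.eq_zero_or_pos (u 1) with h3 | h3
      · have : u 2 ≠ 0 := by omega
        simp [this]
      · have : u 1 ≠ 0 := by omega
        simp [this]
    · intro h
      simp [notMem_support_iff.mp h]
  rw [hc] at hG1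
  refine ⟨_, hG1, ∑ u ∈ G.support.erase (Finsupp.single 0 t),
    coeff u G • (X 0 ^ (u 0) * X 1 ^ (u 1)), ?_, ?_⟩
  · refine Submodule.sum_mem _ fun u hu => Submodule.smul_mem _ _ (Submodule.subset_span ?_)
    rw [Finset.mem_erase] at hu
    have h1 := hdeg u hu.2
    exact ⟨u 0, u 1, hne u hu.2 hu.1, by omega, rfl⟩
  · rw [aeval_def, eval₂_eq', ← Finset.add_sum_erase _ _ (mem_support_iff.mpr hG1)]
    congr 1
    · simp [Fin.prod_univ_three, algebraMap_eq]
    · refine Finset.sum_congr rfl fun u _ => ?_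
      simp [Fin.prod_univ_three, algebraMap_eq, smul_eq_C_mul]

lemma chud_eval_smul {K : Type*} [Field K] {n t : ℕ} (F : MvPolynomial (Fin n) K)
    (hF : F.IsHomogeneous t) (c : K) (v : Fin n → K) :
    eval (c • v) F = c ^ t * eval v F := by
  rw [eval_eq', eval_eq', Finset.mul_sum]
  refine Finset.sum_congr rfl fun u hu => ?_
  have := hF.degree_eq_sum_deg_support hu
  rw [← Finsupp.degree_apply, Finsupp.degree_eq_sum] at this
  simp only [Pi.smul_apply, smul_eq_mul, mul_pow, Finset.prod_mul_distrib,
    Finset.prod_pow_eq_pow_sum, ← this]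
  ring

lemma chud_lin {K : Type*} [Field K] (E : (Fin 3 → K) ≃ₗ[K] (Fin 3 → K)) (v : Fin 3 → K)
    (i : Fin 3) : ∑ j, E (Pi.single j 1) i * v j = E v i := by
  conv_rhs => rw [pi_eq_sum_univ' v]
  simp [Finset.sum_apply, mul_comm]

lemma chud_main {K : Type*} [Field K] [Infinite K] {s : ℕ} (hs : 0 < s)
    (p : Fin s → Fin 3 → K) (hp : ProjDistinct K p) (k t α : ℕ) (hk : 0 < k) (hα : 0 < α)
    (F : MvPolynomial (Fin 3) K) (hF0 : F ≠ 0) (hF : F.IsHomogeneous t)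
    (hFk : ∀ i, F ∈ coneIdeal K (p i) ^ k)
    (hmin : ∀ H : MvPolynomial (Fin 3) K, H.IsHomogeneous (α - 1) →
      (∀ i, H ∈ coneIdeal K (p i)) → H = 0) :
    k * (α + 1) ≤ 2 * t := by
  have hFp : ∀ i, F ∈ coneIdeal K (p i) := fun i => Ideal.pow_le_self hk.ne' (hFk i)
  obtain ⟨q, hq⟩ : ∃ q, eval q F ≠ 0 := by
    by_contra! hcon
    exact hF0 (MvPolynomial.funext fun x => by simpa using hcon x)
  have hpq : ∀ i, ∀ c : K, p i ≠ c • q := by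
    intro i c h
    have hc : c ≠ 0 := by
      rintro rfl
      exact hp.1 i (by simpa using h)
    apply hq
    have := hFp i c⁻¹
    rwa [h, smul_smul, inv_mul_cancel₀ hc, one_smul] at this
  have hq0 : q ≠ 0 := by
    rintro rfl
    apply hq
    have := hFp ⟨0, hs⟩ 0
    rwa [zero_smul] at this
  obtain ⟨E, hEq, hEp⟩ := chud_equiv hs p q hq0 hpq
  let lin : MvPolynomial (Fin 3) K →ₐ[K] MvPolynomial (Fin 3) K :=
    aeval (fun i => ∑ j, C (E.symm (Pi.single j 1) i) * X j)
  have hlin : ∀ v G, eval v (lin G) = eval (E.symm v) G := by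
    intro v G
    have : ((aeval v : MvPolynomial (Fin 3) K →ₐ[K] K).comp lin) = aeval (E.symm v) := by
      ext i
      simp [lin, chud_lin]
    have := DFunLike.congr_fun this G
    simpa [aeval_eq_eval] using this
  let deh : MvPolynomial (Fin 3) K →ₐ[K] MvPolynomial (Fin 2) K :=
    aeval ![(X 0 : MvPolynomial (Fin 2) K), X 1, 1]
  have hdeh : ∀ P G, eval P (deh G) = eval ![P 0, P 1, 1] G := by
    intro P G
    have : ((aeval P : MvPolynomial (Fin 2) K →ₐ[K] K).comp deh) = aeval ![P 0, P 1, 1] := by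
      ext i
      fin_cases i <;> simp [deh]
    have := DFunLike.congr_fun this G
    simpa [aeval_eq_eval] using this
  have hlF : (lin F).IsHomogeneous t := by
    have := hF.aeval (fun i => ∑ j, C (E.symm (Pi.single j 1) i) * X j) (n := 1) (by
      intro i
      exact IsHomogeneous.sum _ _ _ fun j _ => isHomogeneous_C_mul_X _ _)
    rwa [one_mul] at this
  have hlF1 : eval ![1, 0, 0] (lin F) ≠ 0 := by
    rw [hlin, ← hEq, LinearEquiv.symm_apply_apply]; exact hq
  obtain ⟨c, hc, r, hr, hcr⟩ := chud_dehom t (lin F) hlF hlF1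
  let P : Fin s → Fin 2 → K := fun i => ![E (p i) 0 / E (p i) 2, E (p i) 1 / E (p i) 2]
  have hvec : ∀ i, ![P i 0, P i 1, 1] = (E (p i) 2)⁻¹ • E (p i) := by
    intro i
    funext j
    fin_cases j
    · simp [P]; ring
    · simp [P]; ring
    · simp [hEp i]
  have hP : Function.Injective P := by
    intro i j hij
    by_contra hne
    have h1 : (E (p i) 2)⁻¹ • E (p i) = (E (p j) 2)⁻¹ • E (p j) := by
      rw [← hvec, ← hvec, hij]
    rw [← map_smul, ← map_smul] at h1
    have h2 := E.injective h1
    refine hp.2 i j hne (E (p i) 2 * (E (p j) 2)⁻¹) ?_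
    rw [mul_smul, ← h2, smul_smul, mul_inv_cancel₀ (hEp i), one_smul]
  refine chud_aff P hP k t α hα c hc r hr ?_ ?_
  · intro i
    rw [← hcr]
    have hle : coneIdeal K (p i) ≤
        (RingHom.ker (eval (P i))).comap (deh.comp lin) := by
      intro G hG
      rw [Ideal.mem_comap, RingHom.mem_ker]
      change eval (P i) (deh (lin G)) = 0
      rw [hdeh, hlin, hvec, ← map_smul, LinearEquiv.symm_apply_apply]
      exact hG _
    exact (Ideal.le_comap_pow (K := RingHom.ker (eval (P i))) (deh.comp lin) k)
      (Ideal.pow_right_mono hle k (hFk i))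
  · intro h hh hz
    let ℓ : Fin 3 → MvPolynomial (Fin 3) K := fun j => ∑ i, C (E (Pi.single i 1) j) * X i
    have hℓ : ∀ j, (ℓ j).IsHomogeneous 1 := fun j =>
      IsHomogeneous.sum _ _ _ fun i _ => isHomogeneous_C_mul_X _ _
    have hℓe : ∀ v j, eval v (ℓ j) = E v j := by
      intro v j
      simp [ℓ, chud_lin]
    have hex : ∃ H : MvPolynomial (Fin 3) K, H.IsHomogeneous (α - 1) ∧
        ∀ a b : K, eval (E.symm ![a, b, 1]) H = eval ![a, b] h := by
      refine Submodule.span_induction (p := fun h _ => ∃ H : MvPolynomial (Fin 3) K,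
        H.IsHomogeneous (α - 1) ∧ ∀ a b : K, eval (E.symm ![a, b, 1]) H = eval ![a, b] h)
        ?_ ?_ ?_ ?_ hh
      · rintro _ ⟨a, b, hab, rfl⟩
        refine ⟨ℓ 0 ^ a * ℓ 1 ^ b * ℓ 2 ^ (α - 1 - a - b), ?_, ?_⟩
        · have := (((hℓ 0).pow a).mul ((hℓ 1).pow b)).mul ((hℓ 2).pow (α - 1 - a - b))
          convert this using 1
          omega
        · intro x y
          simp [hℓe]
      · exact ⟨0, isHomogeneous_zero _ _ _, by simp⟩
      · rintro x y _ _ ⟨H1, h1, h1'⟩ ⟨H2, h2, h2'⟩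
        exact ⟨H1 + H2, h1.add h2, fun a b => by simp [h1', h2']⟩
      · rintro d x _ ⟨H1, h1, h1'⟩
        refine ⟨C d * H1, h1.C_mul d, fun a b => by simp [h1', smul_eq_C_mul]⟩
    obtain ⟨H, hH, hHe⟩ := hex
    have hH0 : H = 0 := by
      apply hmin H hH
      intro i τ
      have h1 : eval (P i) h = 0 := hz i
      have h2 : P i = ![P i 0, P i 1] := by
        funext j; fin_cases j <;> rfl
      rw [h2, ← hHe, hvec, ← map_smul, LinearEquiv.symm_apply_apply,
        chud_eval_smul H hH] at h1
      rw [chud_eval_smul H hH]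
      have h3 : ((E (p i) 2)⁻¹) ^ (α - 1) ≠ 0 := pow_ne_zero _ (inv_ne_zero (hEp i))
      rw [(mul_eq_zero.mp h1).resolve_left h3, mul_zero]
    apply MvPolynomial.funext
    intro v
    have h2 : v = ![v 0, v 1] := by
      funext j; fin_cases j <;> rfl
    rw [h2, ← hHe, hH0]; simp

lemma chud_nonempty {K : Type*} [Field K] {s : ℕ}
    (p : Fin s → Fin 3 → K) (hp : ProjDistinct K p) (k : ℕ) :
    ∃ (t : ℕ) (F : MvPolynomial (Fin 3) K), F ≠ 0 ∧ F.IsHomogeneous t ∧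
      ∀ i, F ∈ coneIdeal K (p i) ^ k := by
  have h1 : ∀ i, ∃ L : MvPolynomial (Fin 3) K, L ≠ 0 ∧ L.IsHomogeneous 1 ∧
      L ∈ coneIdeal K (p i) := by
    intro i
    obtain ⟨j, hj⟩ := Function.ne_iff.mp (hp.1 i)
    simp only [Pi.zero_apply] at hj
    obtain ⟨l, hl⟩ : ∃ l : Fin 3, l ≠ j := exists_ne j
    refine ⟨C (p i j) * X l - C (p i l) * X j, ?_, ?_, ?_⟩
    · intro h
      have := congrArg (coeff (Finsupp.single l 1)) h
      simp [coeff_C_mul, coeff_X, hl.symm, Finsupp.single_left_inj] at this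
      exact hj this
    · exact (isHomogeneous_C_mul_X _ _).sub (isHomogeneous_C_mul_X _ _)
    · intro τ
      simp; ring
  choose L hL0 hL1 hL2 using h1
  refine ⟨∑ i : Fin s, 1 * k, ∏ i, L i ^ k, ?_, ?_, ?_⟩
  · exact Finset.prod_ne_zero_iff.mpr fun i _ => pow_ne_zero _ (hL0 i)
  · exact IsHomogeneous.prod _ _ _ fun i _ => (hL1 i).pow k
  · intro i
    exact Ideal.mem_of_dvd _ (Finset.dvd_prod_of_mem _ (Finset.mem_univ i))
      (Ideal.pow_mem_pow (hL2 i) k)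

lemma chud_mem {K : Type*} [Field K] {s : ℕ} (p : Fin s → Fin 3 → K) (k t : ℕ) :
    homComp K (fatIdeal K p (fun _ => k)) t ≠ ⊥ ↔
      ∃ F : MvPolynomial (Fin 3) K, F ≠ 0 ∧ F.IsHomogeneous t ∧
      ∀ i, F ∈ coneIdeal K (p i) ^ k := by
  rw [Submodule.ne_bot_iff]
  constructor
  · rintro ⟨F, ⟨h1, h2⟩, h3⟩
    exact ⟨F, h3, h2, fun i => (Ideal.mem_iInf.mp h1) i⟩
  · rintro ⟨F, h3, h2, h1⟩
    exact ⟨F, ⟨Ideal.mem_iInf.mpr h1, h2⟩, h3⟩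

set_option maxHeartbeats 1000000 in
/-- **Chudnovsky's theorem for points in the plane**: for the ideal `I = I(Z)` of a
reduced scheme `Z = p_1 + ⋯ + p_s` of `s` distinct points of `ℙ²`,
`(α(I) + 1)/2 ≤ α̂(I)`. -/
theorem chudnovsky_plane (K : Type*) [Field K] [IsAlgClosed K]
    (s : ℕ) (hs : 0 < s)
    (p : Fin s → (Fin 3 → K)) (hp : ProjDistinct K p) :
    ((alphaDeg K (fatIdeal K p (fun _ => 1)) : ℝ) + 1) / 2
      ≤ waldschmidt K p (fun _ => 1) := by
  have hinf : Infinite K := IsAlgClosed.instInfinite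
  have hmem : ∀ k : ℕ, ∃ F : MvPolynomial (Fin 3) K, F ≠ 0 ∧
      F.IsHomogeneous (alphaDeg K (fatIdeal K p (fun _ => k))) ∧
      ∀ i, F ∈ coneIdeal K (p i) ^ k := by
    intro k
    obtain ⟨t, F, hF⟩ := chud_nonempty p hp k
    have hne : {t : ℕ | homComp K (fatIdeal K p (fun _ => k)) t ≠ ⊥}.Nonempty :=
      ⟨t, (chud_mem p k t).mpr ⟨F, hF⟩⟩
    exact (chud_mem p k _).mp (Nat.sInf_mem hne)
  have hα : 0 < alphaDeg K (fatIdeal K p (fun _ => 1)) := by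
    rw [Nat.pos_iff_ne_zero]
    intro h0
    obtain ⟨F, hF0, hFh, hFm⟩ := hmem 1
    rw [h0] at hFh
    have h1 : eval (0 : Fin 3 → K) F = 0 := by
      have := hFm ⟨0, hs⟩
      rw [pow_one] at this
      have := this 0
      rwa [zero_smul] at this
    have h2 : F = C (coeff 0 F) := by
      rw [← totalDegree_zero_iff_isHomogeneous] at hFh
      exact totalDegree_eq_zero_iff_eq_C.mp hFh
    apply hF0
    rw [h2] at h1 ⊢
    rw [eval_C] at h1
    rw [h1, C_0]
  unfold waldschmidt
  apply le_ciInf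
  intro k
  have hk : (0 : ℕ) < k := k.pos
  have hsy : symbPow K p (fun _ => 1) k = fatIdeal K p (fun _ => (k : ℕ)) := by
    simp [symbPow]
  rw [hsy]
  obtain ⟨F, hF0, hFh, hFm⟩ := hmem k
  have key := chud_main hs p hp k _ _ hk hα F hF0 hFh hFm (by
    intro H hH hHm
    by_contra hne
    have h1 : homComp K (fatIdeal K p (fun _ => 1))
        (alphaDeg K (fatIdeal K p (fun _ => 1)) - 1) ≠ ⊥ :=
      (chud_mem p 1 _).mpr ⟨H, hne, hH, fun i => by rw [pow_one]; exact hHm i⟩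
    have h2 : alphaDeg K (fatIdeal K p (fun _ => 1)) ≤
        alphaDeg K (fatIdeal K p (fun _ => 1)) - 1 := Nat.sInf_le h1
    omega)
  have hkR : (0 : ℝ) < (k : ℕ) := by exact_mod_cast hk
  have keyR : (((k : ℕ) : ℝ)) * ((alphaDeg K (fatIdeal K p (fun _ => 1)) : ℝ) + 1)
      ≤ 2 * (alphaDeg K (fatIdeal K p (fun _ => (k : ℕ))) : ℝ) := by exact_mod_cast key
  rw [le_div_iff₀ hkR]
  linarith

end
end
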